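/- Let 0 < ρ₀ < ρ and suppose a(ε) ≤ b₀ ε|ln ε| for some b₀ > 0, and let v_ε be a global minimizer of E. Then there exist constants λ > 0 and C > 0 such that for every disc D(x₀;r₀) ⊂ D(0;ρ₀) with r₀ ∈ [ε, |ln ε|^{−1/2}], if the boundary estimate ∫_{∂D(x₀;r₀)} (1/2)|∇v_ε|² + ∫_{∂D(x₀;r₀)} (|v_ε|²−μ)²/(4ε²) ≤ λ/r₀ holds, then the renormalized energy on the disc is bounded: 𝓔(v_ε, D(x₀;r₀)) ≤ C. -/

import Mathlib

open MeasureTheory Filter Real Set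
open scoped Topology ENNReal

noncomputable section

/-- We identify the plane with the Euclidean space `ℝ²`. -/
abbrev E2 : Type := EuclideanSpace ℝ (Fin 2)

/-- The standard basis vectors of `ℝ²`. -/
def e2basis (i : Fin 2) : E2 := EuclideanSpace.single i 1

/-- Rotation of a vector by `π/2` (multiplication by `i` in complex notation). -/
def perp (e : E2) : E2 := EuclideanSpace.single 0 (-(e 1)) + EuclideanSpace.single 1 (e 0)

/-- The unit vector `e^{iθ}`. -/
def uvec (θ : ℝ) : E2 := EuclideanSpace.single 0 (Real.cos θ) + EuclideanSpace.single 1 (Real.sin θ)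

/-- The Laplacian of a map `u : ℝ² → ℝ²`. -/
def lap (u : E2 → E2) (x : E2) : E2 :=
  ∑ i : Fin 2, fderiv ℝ (fun y => fderiv ℝ u y (e2basis i)) x (e2basis i)

/-- `|∇u|²`, the squared Hilbert-Schmidt norm of the full gradient of `u : ℝ² → ℝ²`. -/
def gradSq (u : E2 → E2) (x : E2) : ℝ := ∑ i : Fin 2, ‖fderiv ℝ u x (e2basis i)‖ ^ 2

/-- `∑_j ∇u_j · ∇ψ_j`, the Hilbert-Schmidt inner product of the gradients. -/
def gradInner (u ψ : E2 → E2) (x : E2) : ℝ :=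
  ∑ i : Fin 2, (inner ℝ (fderiv ℝ u x (e2basis i)) (fderiv ℝ ψ x (e2basis i)) : ℝ)

/-- Membership in `H¹(ℝ²,ℝ²)`: `u ∈ L²` together with its gradient. -/
def MemH1 (u : E2 → E2) : Prop :=
  Differentiable ℝ u ∧ MemLp u 2 (volume : Measure E2) ∧
    MemLp (fun x => fderiv ℝ u x) 2 (volume : Measure E2)

/-- The Ginzburg–Landau energy
`E(u) = ∫ (1/2)|∇u|² − (1/(2ε²))μ|u|² + (1/(4ε²))|u|⁴ − (a/ε) f·u`. -/
def energy (ε a : ℝ) (μ : E2 → ℝ) (f : E2 → E2) (u : E2 → E2) : ℝ :=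
  ∫ x : E2, ((1/2) * gradSq u x - (1/(2*ε^2)) * μ x * ‖u x‖^2
    + (1/(4*ε^2)) * ‖u x‖^4 - (a/ε) * (inner ℝ (f x) (u x) : ℝ))

/-- `v` is a global minimizer of `E` over `H¹(ℝ²,ℝ²)`. -/
def IsMinimizer (ε a : ℝ) (μ : E2 → ℝ) (f : E2 → E2) (v : E2 → E2) : Prop :=
  MemH1 v ∧ ∀ u : E2 → E2, MemH1 u → energy ε a μ f v ≤ energy ε a μ f u

/-- `u` is a smooth classical solution of the Euler–Lagrange equation
`ε²Δu + μu − |u|²u + εa f = 0` on `ℝ²`. -/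
def IsSolution (ε a : ℝ) (μ : E2 → ℝ) (f : E2 → E2) (u : E2 → E2) : Prop :=
  ContDiff ℝ (⊤ : ℕ∞) u ∧ ∀ x : E2, ε^2 • lap u x + μ x • u x - ‖u x‖^2 • u x + (ε*a) • f x = 0

/-- Hypotheses on the radial coefficient `μ`. -/
structure MuHyp (μ : E2 → ℝ) (μrad : ℝ → ℝ) (ρ : ℝ) : Prop where
  smooth : ContDiff ℝ (⊤ : ℕ∞) μ
  smooth_rad : ContDiff ℝ (⊤ : ℕ∞) μrad
  even_rad : ∀ r : ℝ, μrad (-r) = μrad r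
  radial : ∀ x : E2, μ x = μrad ‖x‖
  bdd : ∃ C : ℝ, ∀ x : E2, |μ x| ≤ C
  deriv_neg : ∀ r : ℝ, 0 < r → deriv μrad r < 0
  rho_pos : 0 < ρ
  rho_root : μrad ρ = 0
  rho_unique : ∀ r : ℝ, 0 < r → μrad r = 0 → r = ρ

/-- Hypotheses on the radial vector field `f`. -/
structure FHyp (f : E2 → E2) (frad : ℝ → ℝ) : Prop where
  smooth : ContDiff ℝ (⊤ : ℕ∞) f
  smooth_rad : ContDiff ℝ (⊤ : ℕ∞) frad
  odd_rad : ∀ r : ℝ, frad (-r) = -frad r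
  radial : ∀ x : E2, x ≠ 0 → f x = (frad ‖x‖ / ‖x‖) • x
  integrable : Integrable f (volume : Measure E2)
  bdd : ∃ C : ℝ, ∀ x : E2, ‖f x‖ ≤ C
  pos_rad : ∀ r : ℝ, 0 < r → 0 < frad r

/-- Convergence in `C²_loc(ℝ²,ℝ²)` of a sequence of maps. -/
def TendstoC2LocSeq (F : ℕ → E2 → E2) (g : E2 → E2) : Prop :=
  TendstoLocallyUniformly F g atTop ∧
  TendstoLocallyUniformly (fun n x => fderiv ℝ (F n) x) (fun x => fderiv ℝ g x) atTop ∧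
  TendstoLocallyUniformly (fun n x => fderiv ℝ (fderiv ℝ (F n)) x)
    (fun x => fderiv ℝ (fderiv ℝ g) x) atTop

/-- `l` is a limit point (as `ε → 0`) of the set of zeros of the family `v ε`. -/
def IsZeroLimitPoint (v : ℝ → E2 → E2) (l : E2) : Prop :=
  ∃ (εs : ℕ → ℝ) (xs : ℕ → E2), (∀ n, 0 < εs n) ∧ Tendsto εs atTop (𝓝 (0:ℝ)) ∧
    (∀ n, v (εs n) (xs n) = 0) ∧ Tendsto xs atTop (𝓝 l)

/-- The local renormalized energy `𝓔(u,Ω)`. -/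
def renormOn (ε a : ℝ) (μ : E2 → ℝ) (f : E2 → E2) (ρ : ℝ) (u : E2 → E2) (Ω : Set E2) : ℝ :=
  (∫ x in Ω, (1/2) * gradSq u x)
  + (∫ x in Ω ∩ Metric.ball (0:E2) ρ, (‖u x‖^2 - μ x)^2 / (4*ε^2))
  + (∫ x in Ω \ Metric.closedBall (0:E2) ρ, ‖u x‖^2 * (‖u x‖^2 - 2*μ x) / (4*ε^2))
  - (a/ε) * ∫ x in Ω, (inner ℝ (f x) (u x) : ℝ)


/-- Second-order necessary condition at a local maximum in dimension one. -/
lemma second_deriv_nonpos {k k1 : ℝ → ℝ} {k2 t : ℝ}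
    (h1 : ∀ s, HasDerivAt k (k1 s) s) (h2 : HasDerivAt k1 k2 t) (hm : IsLocalMax k t) :
    k2 ≤ 0 := by
  by_contra hpos
  push Not at hpos
  have e1 : deriv k = k1 := funext fun s => (h1 s).deriv
  have hd : k1 t = 0 := by
    have := hm.deriv_eq_zero
    rwa [e1] at this
  have hmin : IsLocalMin k t := by
    apply isLocalMin_of_deriv_deriv_pos
    · rw [e1, h2.deriv]; exact hpos
    · rw [e1, hd]
    · exact (h1 t).continuousAt
  have hconst : k =ᶠ[𝓝 t] fun _ => k t := by
    filter_upwards [hm, hmin] with s hs1 hs2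
    exact le_antisymm hs1 hs2
  have : k1 =ᶠ[𝓝 t] fun _ => (0:ℝ) := by
    have := hconst.deriv
    rw [e1] at this
    simpa using this
  have h3 := this.deriv_eq
  rw [h2.deriv] at h3
  simp at h3
  linarith

/-- Weak maximum principle on a rectangle. -/
lemma max_principle {d : ℝ} (hd : 0 < d) (w ws wss wt wtt : ℝ → ℝ → ℝ)
    (hc : Continuous (Function.uncurry w))
    (hs1 : ∀ s t, HasDerivAt (fun s => w s t) (ws s t) s)
    (hs2 : ∀ s t, HasDerivAt (fun s => ws s t) (wss s t) s)
    (ht1 : ∀ s t, HasDerivAt (fun t => w s t) (wt s t) t)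
    (ht2 : ∀ s t, HasDerivAt (fun t => wt s t) (wtt s t) t)
    (hpos : ∀ s t, |s| ≤ d → 0 ≤ t → t ≤ d → 0 < wss s t + wtt s t)
    (hb1 : ∀ t, 0 ≤ t → t ≤ d → w d t ≤ 0)
    (hb2 : ∀ t, 0 ≤ t → t ≤ d → w (-d) t ≤ 0)
    (hb3 : ∀ s, |s| ≤ d → w s 0 ≤ 0)
    (hb4 : ∀ s, |s| ≤ d → w s d ≤ 0) :
    ∀ s t, |s| ≤ d → 0 ≤ t → t ≤ d → w s t ≤ 0 := by
  intro s t hs h0 h1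
  have hK : IsCompact (Icc (-d) d ×ˢ Icc 0 d) := isCompact_Icc.prod isCompact_Icc
  obtain ⟨⟨p, q⟩, hpq, hmax⟩ := hK.exists_isMaxOn
    ⟨(s, t), ⟨abs_le.1 hs, ⟨h0, h1⟩⟩⟩ hc.continuousOn
  have hle : w s t ≤ w p q := hmax (show (s, t) ∈ _ from ⟨abs_le.1 hs, ⟨h0, h1⟩⟩)
  refine hle.trans ?_
  obtain ⟨⟨hp1, hp2⟩, ⟨hq1, hq2⟩⟩ := hpq
  simp only at hp1 hp2 hq1 hq2
  have hpa : |p| ≤ d := abs_le.2 ⟨hp1, hp2⟩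
  by_contra hcon
  push Not at hcon
  have hp1' : -d < p := lt_of_le_of_ne hp1 (by rintro rfl; linarith [hb2 q hq1 hq2])
  have hp2' : p < d := lt_of_le_of_ne hp2 (by rintro rfl; linarith [hb1 q hq1 hq2])
  have hq1' : 0 < q := lt_of_le_of_ne hq1 (by rintro rfl; linarith [hb3 p hpa])
  have hq2' : q < d := lt_of_le_of_ne hq2 (by rintro rfl; linarith [hb4 p hpa])
  have m1 : IsLocalMax (fun s => w s q) p := by
    filter_upwards [Icc_mem_nhds hp1' hp2'] with x hx
    exact hmax (show (x, q) ∈ _ from ⟨hx, hq1, hq2⟩)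
  have m2 : IsLocalMax (fun t => w p t) q := by
    filter_upwards [Icc_mem_nhds hq1' hq2'] with x hx
    exact hmax (show (p, x) ∈ _ from ⟨⟨hp1, hp2⟩, hx⟩)
  have k1 := second_deriv_nonpos (fun s => hs1 s q) (hs2 p q) m1
  have k2 := second_deriv_nonpos (fun s => ht1 p s) (ht2 p q) m2
  linarith [hpos p q hpa hq1 hq2]

/-- One-sided interior gradient estimate (reflection and barrier). -/
lemma grad_est_one {d M N : ℝ} (hd : 0 < d) (hN : 0 ≤ N) (hM : 0 ≤ M)
    (U Us Uss Ut Utt : ℝ → ℝ → ℝ)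
    (hc : Continuous (Function.uncurry U))
    (hs1 : ∀ s t, HasDerivAt (fun s => U s t) (Us s t) s)
    (hs2 : ∀ s t, HasDerivAt (fun s => Us s t) (Uss s t) s)
    (ht1 : ∀ s t, HasDerivAt (fun t => U s t) (Ut s t) t)
    (ht2 : ∀ s t, HasDerivAt (fun t => Ut s t) (Utt s t) t)
    (hUM : ∀ s t, |s| ≤ d → |t| ≤ d → |U s t| ≤ M)
    (hUN : ∀ s t, |s| ≤ d → |t| ≤ d → |Uss s t + Utt s t| ≤ N)
    (h : ℝ) (h0 : 0 ≤ h) (h1 : h ≤ d) :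
    U 0 h - U 0 (-h) ≤ 2 * (2 * M / d + (N + 1) * d / 2) * h := by
  have habs : ∀ t, 0 ≤ t → t ≤ d → |t| ≤ d ∧ |-t| ≤ d := fun t a b => by
    rw [abs_neg, abs_of_nonneg a]; exact ⟨b, b⟩
  have hdd : |d| ≤ d := (abs_of_pos hd).le
  have key := max_principle hd
    (fun s t => (U s t - U s (-t)) / 2 - (M / d ^ 2 * (s ^ 2 + t * (2 * d - t))
      + (N + 1) * (t * (d - t)) / 2))
    (fun s t => (Us s t - Us s (-t)) / 2 - M / d ^ 2 * (2 * s))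
    (fun s t => (Uss s t - Uss s (-t)) / 2 - M / d ^ 2 * 2)
    (fun s t => (Ut s t + Ut s (-t)) / 2 - (M / d ^ 2 * (2 * d - 2 * t)
      + (N + 1) * (d - 2 * t) / 2))
    (fun s t => (Utt s t - Utt s (-t)) / 2 - (M / d ^ 2 * (-2)
      + (N + 1) * (-2) / 2)) ?_ ?_ ?_ ?_ ?_ ?_ ?_ ?_ ?_ ?_ 0 h (by simpa using hd.le) h0 h1
  · beta_reduce at key
    have e : 2 * (2 * M / d + (N + 1) * d / 2) * h = 2 * (M / d ^ 2 * (h * (2 * d))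
      + (N + 1) * (h * d) / 2) := by field_simp
    rw [e]
    have : 0 ≤ M / d ^ 2 * h ^ 2 := by positivity
    have : 0 ≤ (N + 1) * h ^ 2 := by positivity
    nlinarith
  · have : Continuous fun p : ℝ × ℝ => U p.1 (-p.2) :=
      hc.comp (continuous_fst.prodMk continuous_snd.neg)
    have h2 : Continuous fun p : ℝ × ℝ => U p.1 p.2 := hc
    simp only [Function.uncurry_def]
    fun_prop
  · intro s t
    refine HasDerivAt.congr_deriv ((((hs1 s t).sub (hs1 s (-t))).div_const 2).sub
      (((((hasDerivAt_id s).pow 2).add_const (t * (2 * d - t))).const_mul (M / d ^ 2)).add_const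
        ((N + 1) * (t * (d - t)) / 2))) ?_
    simp
  · intro s t
    refine HasDerivAt.congr_deriv ((((hs2 s t).sub (hs2 s (-t))).div_const 2).sub
      (((hasDerivAt_id s).const_mul 2).const_mul (M / d ^ 2))) ?_
    simp
  · intro s t
    have hn := (ht1 s (-t)).scomp t (hasDerivAt_neg t)
    have hq : HasDerivAt (fun t : ℝ => t * (2 * d - t)) (2 * d - 2 * t) t := by
      refine HasDerivAt.congr_deriv ((hasDerivAt_id t).mul ((hasDerivAt_id t).const_sub (2 * d))) ?_
      simp; ring
    have hq2 : HasDerivAt (fun t : ℝ => t * (d - t)) (d - 2 * t) t := by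
      refine HasDerivAt.congr_deriv ((hasDerivAt_id t).mul ((hasDerivAt_id t).const_sub d)) ?_
      simp; ring
    refine HasDerivAt.congr_deriv ((((ht1 s t).sub hn).div_const 2).sub
      (((hq.const_add (s ^ 2)).const_mul (M / d ^ 2)).add ((hq2.const_mul (N + 1)).div_const 2))) ?_
    simp
  · intro s t
    have hn := (ht2 s (-t)).scomp t (hasDerivAt_neg t)
    have hq : HasDerivAt (fun t : ℝ => 2 * d - 2 * t) (-2) t := by
      refine HasDerivAt.congr_deriv (((hasDerivAt_id t).const_mul 2).const_sub (2 * d)) ?_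
      simp
    have hq2 : HasDerivAt (fun t : ℝ => d - 2 * t) (-2) t := by
      refine HasDerivAt.congr_deriv (((hasDerivAt_id t).const_mul 2).const_sub d) ?_
      simp
    refine HasDerivAt.congr_deriv ((((ht2 s t).add hn).div_const 2).sub
      ((hq.const_mul (M / d ^ 2)).add ((hq2.const_mul (N + 1)).div_const 2))) ?_
    simp; ring
  · intro s t hs a b
    have k1 := abs_le.1 (hUN s t hs (habs t a b).1)
    have k2 := abs_le.1 (hUN s (-t) hs (habs t a b).2)
    linarith [k1.1, k2.2]
  · intro t a b
    have k1 := abs_le.1 (hUM d t hdd (habs t a b).1)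
    have k2 := abs_le.1 (hUM d (-t) hdd (habs t a b).2)
    have e1 : M / d ^ 2 * (d ^ 2 + t * (2 * d - t)) = M + M / d ^ 2 * (t * (2 * d - t)) := by
      field_simp
    have p1 : 0 ≤ M / d ^ 2 * (t * (2 * d - t)) :=
      mul_nonneg (by positivity) (mul_nonneg a (by linarith))
    have p2 : 0 ≤ (N + 1) * (t * (d - t)) :=
      mul_nonneg (by positivity) (mul_nonneg a (by linarith))
    rw [e1]
    linarith [k1.2, k2.1]
  · intro t a b
    have k1 := abs_le.1 (hUM (-d) t (by rwa [abs_neg]) (habs t a b).1)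
    have k2 := abs_le.1 (hUM (-d) (-t) (by rwa [abs_neg]) (habs t a b).2)
    have e1 : M / d ^ 2 * ((-d) ^ 2 + t * (2 * d - t)) = M + M / d ^ 2 * (t * (2 * d - t)) := by
      field_simp
    have p1 : 0 ≤ M / d ^ 2 * (t * (2 * d - t)) :=
      mul_nonneg (by positivity) (mul_nonneg a (by linarith))
    have p2 : 0 ≤ (N + 1) * (t * (d - t)) :=
      mul_nonneg (by positivity) (mul_nonneg a (by linarith))
    rw [e1]
    linarith [k1.2, k2.1]
  · intro s _
    have : 0 ≤ M / d ^ 2 * s ^ 2 := by positivity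
    simp
    exact this
  · intro s hs
    have k1 := abs_le.1 (hUM s d hs hdd)
    have k2 := abs_le.1 (hUM s (-d) hs (by rwa [abs_neg]))
    have e1 : M / d ^ 2 * (s ^ 2 + d * (2 * d - d)) = M + M / d ^ 2 * s ^ 2 := by
      field_simp; ring
    have : 0 ≤ M / d ^ 2 * s ^ 2 := by positivity
    rw [e1]
    simp only [sub_self, mul_zero]
    linarith [k1.2, k2.1]

/-- Two-sided interior gradient estimate. -/
lemma grad_est {d M N : ℝ} (hd : 0 < d) (hN : 0 ≤ N) (hM : 0 ≤ M)
    (U Us Uss Ut Utt : ℝ → ℝ → ℝ)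
    (hc : Continuous (Function.uncurry U))
    (hs1 : ∀ s t, HasDerivAt (fun s => U s t) (Us s t) s)
    (hs2 : ∀ s t, HasDerivAt (fun s => Us s t) (Uss s t) s)
    (ht1 : ∀ s t, HasDerivAt (fun t => U s t) (Ut s t) t)
    (ht2 : ∀ s t, HasDerivAt (fun t => Ut s t) (Utt s t) t)
    (hUM : ∀ s t, |s| ≤ d → |t| ≤ d → |U s t| ≤ M)
    (hUN : ∀ s t, |s| ≤ d → |t| ≤ d → |Uss s t + Utt s t| ≤ N)
    (h : ℝ) (h0 : 0 ≤ h) (h1 : h ≤ d) :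
    |U 0 h - U 0 (-h)| ≤ 2 * (2 * M / d + (N + 1) * d / 2) * h := by
  rw [abs_le]
  constructor
  · have := grad_est_one hd hN hM (fun s t => -U s t) (fun s t => -Us s t) (fun s t => -Uss s t)
      (fun s t => -Ut s t) (fun s t => -Utt s t) hc.neg (fun s t => (hs1 s t).neg)
      (fun s t => (hs2 s t).neg) (fun s t => (ht1 s t).neg) (fun s t => (ht2 s t).neg)
      (fun s t a b => by rw [abs_neg]; exact hUM s t a b)
      (fun s t a b => by rw [← neg_add, abs_neg]; exact hUN s t a b) h h0 h1
    linarith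
  · exact grad_est_one hd hN hM U Us Uss Ut Utt hc hs1 hs2 ht1 ht2 hUM hUN h h0 h1


/-- The energy density. -/
def dens (ε a : ℝ) (μ : E2 → ℝ) (f : E2 → E2) (u : E2 → E2) (x : E2) : ℝ :=
  (1/2) * gradSq u x - (1/(2*ε^2)) * μ x * ‖u x‖^2
    + (1/(4*ε^2)) * ‖u x‖^4 - (a/ε) * (inner ℝ (f x) (u x) : ℝ)

lemma energy_eq (ε a : ℝ) (μ : E2 → ℝ) (f u : E2 → E2) :
    energy ε a μ f u = ∫ x, dens ε a μ f u x := rfl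

lemma e2basis_norm (i : Fin 2) : ‖e2basis i‖ = 1 := by simp [e2basis]

lemma gradSq_cont {ψ : E2 → E2} (h : ContDiff ℝ 1 ψ) : Continuous (gradSq ψ) := by
  have := h.continuous_fderiv (by norm_num)
  unfold gradSq
  fun_prop

lemma gradSq_supp {ψ : E2 → E2} (h : HasCompactSupport ψ) : HasCompactSupport (gradSq ψ) := by
  refine (h.fderiv (𝕜 := ℝ)).mono fun x hx => ?_
  rw [Function.mem_support] at hx ⊢
  contrapose! hx
  simp [gradSq, hx]

lemma memLp_add' {F : Type*} [NormedAddCommGroup F] {a b : E2 → F}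
    (h1 : MemLp a 2 (volume : Measure E2)) (h2 : MemLp b 2 (volume : Measure E2)) :
    MemLp (fun x => a x + b x) 2 (volume : Measure E2) := h1.add h2

lemma int_comb4 {F1 F2 F3 F4 : E2 → ℝ} (h1 : Integrable F1) (h2 : Integrable F2)
    (h3 : Integrable F3) (h4 : Integrable F4) (t1 t2 t3 t4 : ℝ) :
    Integrable (fun x => t1 * F1 x + t2 * F2 x + t3 * F3 x + t4 * F4 x) ∧
    ∫ x, (t1 * F1 x + t2 * F2 x + t3 * F3 x + t4 * F4 x) =
      t1 * (∫ x, F1 x) + t2 * (∫ x, F2 x) + t3 * (∫ x, F3 x) + t4 * (∫ x, F4 x) := by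
  have j1 := h1.const_mul t1
  have j2 := h2.const_mul t2
  have j3 := h3.const_mul t3
  have j4 := h4.const_mul t4
  have k2 := j1.fun_add j2
  have k3 := k2.fun_add j3
  refine ⟨k3.fun_add j4, ?_⟩
  rw [integral_add k3 j4, integral_add k2 j3, integral_add j1 j2, integral_const_mul,
    integral_const_mul, integral_const_mul, integral_const_mul]

lemma memH1_add_smooth {v ψ : E2 → E2} (hv : MemH1 v) (h : ContDiff ℝ 1 ψ)
    (hs : HasCompactSupport ψ) : MemH1 (fun x => v x + ψ x) := by
  have hd := h.differentiable (by norm_num)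
  have m1 : MemLp ψ 2 (volume : Measure E2) := h.continuous.memLp_of_hasCompactSupport hs
  refine ⟨hv.1.add hd, hv.2.1.add m1, ?_⟩
  have m2 : MemLp (fun x => fderiv ℝ ψ x) 2 (volume : Measure E2) :=
    (h.continuous_fderiv (by norm_num)).memLp_of_hasCompactSupport (hs.fderiv (𝕜 := ℝ))
  have : (fun x => fderiv ℝ (fun x => v x + ψ x) x) =
      fun x => fderiv ℝ v x + fderiv ℝ ψ x := by
    funext x
    exact fderiv_fun_add (hv.1 x) (hd x)
  rw [this]
  exact memLp_add' hv.2.2 m2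

lemma memH1_smooth {ψ : E2 → E2} (h : ContDiff ℝ 1 ψ)
    (hs : HasCompactSupport ψ) : MemH1 ψ := 
  ⟨h.differentiable (by norm_num), h.continuous.memLp_of_hasCompactSupport hs,
    (h.continuous_fderiv (by norm_num)).memLp_of_hasCompactSupport (hs.fderiv (𝕜 := ℝ))⟩

lemma gradInner_integrable {v ψ : E2 → E2} (hv : MemH1 v) (h : ContDiff ℝ 1 ψ)
    (hs : HasCompactSupport ψ) : Integrable (gradInner v ψ) := by
  have h2 : MemLp (fun x => fderiv ℝ ψ x) 2 (volume : Measure E2) := 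
    (h.continuous_fderiv (by norm_num)).memLp_of_hasCompactSupport (hs.fderiv (𝕜 := ℝ))
  have h1 := hv.2.2
  unfold gradInner
  refine integrable_finsetSum _ fun i _ => ?_
  have hb := (h1.norm).integrable_mul (h2.norm)
  refine hb.mono' ?_ ?_
  · exact ((h1.1.apply_continuousLinearMap _).inner (h2.1.apply_continuousLinearMap _))
  · refine Eventually.of_forall fun x => (norm_inner_le_norm _ _).trans ?_
    have := (fderiv ℝ v x).le_opNorm (e2basis i)
    have h4 := (fderiv ℝ ψ x).le_opNorm (e2basis i)
    rw [e2basis_norm, mul_one] at this h4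
    exact mul_le_mul this h4 (norm_nonneg _) (norm_nonneg _)

lemma gradSq_add_smul {v ψ : E2 → E2} {x : E2} (hv : DifferentiableAt ℝ v x)
    (h : DifferentiableAt ℝ ψ x) (t : ℝ) :
    gradSq (fun x => v x + t • ψ x) x = gradSq v x + 2 * t * gradInner v ψ x
      + t ^ 2 * gradSq ψ x := by
  have e : fderiv ℝ (fun x => v x + t • ψ x) x = fderiv ℝ v x + t • fderiv ℝ ψ x := by
    exact (hv.hasFDerivAt.add (h.hasFDerivAt.const_smul t)).fderiv
  unfold gradSq gradInner
  rw [e, Finset.mul_sum, Finset.mul_sum, ← Finset.sum_add_distrib, ← Finset.sum_add_distrib]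
  refine Finset.sum_congr rfl fun i _ => ?_
  simp only [add_apply, smul_apply]
  rw [norm_add_sq_real, norm_smul, inner_smul_right, mul_pow]
  simp
  ring

/-- The nonlinearity in the Euler-Lagrange equation. -/
def gEL (ε a : ℝ) (μ : E2 → ℝ) (f v : E2 → E2) (x : E2) : E2 :=
  ((μ x - ‖v x‖^2) / ε^2) • v x + (a/ε) • f x

lemma dens_add_smul {ε a : ℝ} (hε : 0 < ε) {μ : E2 → ℝ} {f v ψ : E2 → E2} {x : E2}
    (hv : DifferentiableAt ℝ v x) (h : DifferentiableAt ℝ ψ x) (t : ℝ) :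
    dens ε a μ f (fun x => v x + t • ψ x) x - dens ε a μ f v x =
      t * (gradInner v ψ x - inner ℝ (gEL ε a μ f v x) (ψ x))
      + t^2 * ((1/2) * gradSq ψ x - μ x * ‖ψ x‖^2 / (2*ε^2)
          + ((inner ℝ (v x) (ψ x))^2 + ‖v x‖^2 * ‖ψ x‖^2 / 2) / ε^2)
      + t^3 * (inner ℝ (v x) (ψ x) * ‖ψ x‖^2 / ε^2)
      + t^4 * (‖ψ x‖^4 / (4*ε^2)) := by
  unfold dens gEL
  rw [gradSq_add_smul hv h]
  have e : ‖v x + t • ψ x‖^2 = ‖v x‖^2 + 2 * t * inner ℝ (v x) (ψ x) + t^2 * ‖ψ x‖^2 := by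
    rw [norm_add_sq_real, norm_smul, inner_smul_right, mul_pow]; simp; ring
  have e4 : ∀ p : E2, ‖p‖^4 = (‖p‖^2)^2 := fun p => by ring
  rw [e4 (v x + t • ψ x), e, inner_add_left, inner_smul_left, inner_smul_left, inner_add_right,
    inner_smul_right]
  simp
  field_simp
  ring

section
variable {ε a : ℝ} {μ : E2 → ℝ} {f v : E2 → E2}

lemma dens_diff_integrable (hε : 0 < ε) (hμ : Continuous μ) (hf : Continuous f)
    (hv : MemH1 v) {ψ : E2 → E2} (h : ContDiff ℝ 1 ψ) (hs : HasCompactSupport ψ) :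
    Integrable (fun x => gradInner v ψ x - inner ℝ (gEL ε a μ f v x) (ψ x)) ∧
    Integrable (fun x => (1/2) * gradSq ψ x - μ x * ‖ψ x‖^2 / (2*ε^2)
          + ((inner ℝ (v x) (ψ x))^2 + ‖v x‖^2 * ‖ψ x‖^2 / 2) / ε^2) ∧
    Integrable (fun x => inner ℝ (v x) (ψ x) * ‖ψ x‖^2 / ε^2) ∧
    Integrable (fun x => ‖ψ x‖^4 / (4*ε^2)) := by
  have cv := hv.1.continuous
  have cψ := h.continuous
  have cg := gradSq_cont h
  have sg := gradSq_supp hs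
  have key : ∀ F : E2 → ℝ, Continuous F → (∀ x, ψ x = 0 → F x = 0) → Integrable F := by
    intro F hF h0
    refine hF.integrable_of_hasCompactSupport (hs.mono fun x hx => ?_)
    rw [Function.mem_support] at hx ⊢
    exact fun h => hx (h0 x h)
  refine ⟨(gradInner_integrable hv h hs).sub ?_, ?_, ?_, ?_⟩
  · apply key
    · unfold gEL; fun_prop
    · intro x hx; simp [hx]
  · have : Integrable (gradSq ψ) := cg.integrable_of_hasCompactSupport sg
    have h2 : Integrable (fun x => - μ x * ‖ψ x‖^2 / (2*ε^2)
          + ((inner ℝ (v x) (ψ x))^2 + ‖v x‖^2 * ‖ψ x‖^2 / 2) / ε^2) := by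
      apply key
      · fun_prop
      · intro x hx; simp [hx]
    refine ((this.const_mul (1/2)).add h2).congr (Eventually.of_forall fun x => ?_)
    simp only [Pi.add_apply]; ring
  · apply key
    · fun_prop
    · intro x hx; simp [hx]
  · apply key
    · fun_prop
    · intro x hx; simp [hx]

/-- Energy comparison for smooth compactly supported perturbations. -/
lemma compare_smooth (hε : 0 < ε) (hμ : Continuous μ) (hf : Continuous f)
    (hm : IsMinimizer ε a μ f v) (hi : Integrable (dens ε a μ f v))
    {ψ : E2 → E2} (h : ContDiff ℝ 1 ψ) (hs : HasCompactSupport ψ) (t : ℝ) :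
    0 ≤ t * (∫ x, (gradInner v ψ x - inner ℝ (gEL ε a μ f v x) (ψ x)))
      + t^2 * (∫ x, ((1/2) * gradSq ψ x - μ x * ‖ψ x‖^2 / (2*ε^2)
          + ((inner ℝ (v x) (ψ x))^2 + ‖v x‖^2 * ‖ψ x‖^2 / 2) / ε^2))
      + t^3 * (∫ x, (inner ℝ (v x) (ψ x) * ‖ψ x‖^2 / ε^2))
      + t^4 * (∫ x, (‖ψ x‖^4 / (4*ε^2))) := by
  obtain ⟨i1, i2, i3, i4⟩ := dens_diff_integrable (a := a) hε hμ hf hm.1 h hs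
  have hd := h.differentiable (by norm_num)
  have hs' : HasCompactSupport (fun x => t • ψ x) :=
    hs.mono fun x hx => by
      rw [Function.mem_support] at hx ⊢
      intro h0
      exact hx (by rw [h0, smul_zero])
  have h' : ContDiff ℝ 1 (fun x => t • ψ x) := by fun_prop
  have hle := hm.2 (fun x => v x + t • ψ x) (memH1_add_smooth hm.1 h' hs')
  rw [energy_eq, energy_eq] at hle
  have e : ∀ x, dens ε a μ f (fun x => v x + t • ψ x) x = dens ε a μ f v x + (t * (gradInner v ψ x - inner ℝ (gEL ε a μ f v x) (ψ x))
      + t^2 * ((1/2) * gradSq ψ x - μ x * ‖ψ x‖^2 / (2*ε^2)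
          + ((inner ℝ (v x) (ψ x))^2 + ‖v x‖^2 * ‖ψ x‖^2 / 2) / ε^2)
      + t^3 * (inner ℝ (v x) (ψ x) * ‖ψ x‖^2 / ε^2)
      + t^4 * (‖ψ x‖^4 / (4*ε^2))) := fun x => by
    rw [← dens_add_smul hε (hm.1.1 x) (hd x) t]; ring
  simp_rw [e] at hle
  obtain ⟨j, hj⟩ := int_comb4 i1 i2 i3 i4 t (t^2) (t^3) (t^4)
  rw [integral_add hi j, hj] at hle
  linarith

/-- Weak Euler-Lagrange equation. -/
lemma weak_EL (hε : 0 < ε) (hμ : Continuous μ) (hf : Continuous f)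
    (hm : IsMinimizer ε a μ f v) (hi : Integrable (dens ε a μ f v))
    {ψ : E2 → E2} (h : ContDiff ℝ 1 ψ) (hs : HasCompactSupport ψ) :
    ∫ x, (gradInner v ψ x - inner ℝ (gEL ε a μ f v x) (ψ x)) = 0 := by
  have key := compare_smooth hε hμ hf hm hi h hs
  generalize (∫ x, (gradInner v ψ x - inner ℝ (gEL ε a μ f v x) (ψ x))) = c1 at key ⊢
  generalize (∫ x, ((1/2) * gradSq ψ x - μ x * ‖ψ x‖^2 / (2*ε^2)
          + ((inner ℝ (v x) (ψ x))^2 + ‖v x‖^2 * ‖ψ x‖^2 / 2) / ε^2)) = c2 at key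
  generalize (∫ x, (inner ℝ (v x) (ψ x) * ‖ψ x‖^2 / ε^2)) = c3 at key
  generalize (∫ x, (‖ψ x‖^4 / (4*ε^2))) = c4 at key
  have hmin : IsLocalMin (fun t : ℝ => t * c1 + t^2 * c2 + t^3 * c3 + t^4 * c4) 0 := by
    refine Eventually.of_forall fun t => ?_
    simpa using key t
  have hder : HasDerivAt (fun t : ℝ => t * c1 + t^2 * c2 + t^3 * c3 + t^4 * c4) c1 0 := by
    refine HasDerivAt.congr_deriv (((((hasDerivAt_id (0:ℝ)).mul_const c1).add
      (((hasDerivAt_id (0:ℝ)).pow 2).mul_const c2)).add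
      (((hasDerivAt_id (0:ℝ)).pow 3).mul_const c3)).add
      (((hasDerivAt_id (0:ℝ)).pow 4).mul_const c4)) ?_
    simp
  exact hmin.hasDerivAt_eq_zero hder

end

lemma mu_pos {μ : E2 → ℝ} {μrad : ℝ → ℝ} {ρ : ℝ} (hμ : MuHyp μ μrad ρ) {ρ0 : ℝ} (h0 : 0 < ρ0)
    (h1 : ρ0 < ρ) : 0 < μrad ρ0 ∧ ∀ x ∈ Metric.closedBall (0:E2) ρ0, μrad ρ0 ≤ μ x := by
  have hanti : StrictAntiOn μrad (Ici 0) := by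
    apply strictAntiOn_of_deriv_neg (convex_Ici 0) hμ.smooth_rad.continuous.continuousOn
    intro x hx
    rw [interior_Ici] at hx
    exact hμ.deriv_neg x hx
  constructor
  · rw [← hμ.rho_root]
    exact hanti h0.le hμ.rho_pos.le h1
  · intro x hx
    rw [hμ.radial]
    exact hanti.antitoneOn (norm_nonneg x) h0.le (by simpa using hx)

/-- For small `ε` the minimal energy is negative, hence the density is integrable. -/
lemma dens_integrable {μ : E2 → ℝ} {μrad : ℝ → ℝ} {ρ : ℝ} {f : E2 → E2}
    (hμ : MuHyp μ μrad ρ) (hf : Continuous f) {ρ0 : ℝ} (h0 : 0 < ρ0) (h1 : ρ0 < ρ) :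
    ∃ ε₁ : ℝ, 0 < ε₁ ∧ ∀ ε a : ℝ, ∀ v, 0 < ε → ε < ε₁ → IsMinimizer ε a μ f v →
      Integrable (dens ε a μ f v) := by
  obtain ⟨hm0, hmge⟩ := mu_pos hμ h0 h1
  let χ : ContDiffBump (0:E2) := ⟨ρ0/2, ρ0, by linarith, by linarith⟩
  let u : E2 → E2 := fun x => χ x • e2basis 0
  have hu : ContDiff ℝ 1 u := χ.contDiff.smul contDiff_const
  have hus : HasCompactSupport u := χ.hasCompactSupport.smul_right
  have cu := hu.continuous
  have cμ := hμ.smooth.continuous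
  have nu : ∀ x, ‖u x‖ = χ x := fun x => by
    simp only [u]
    rw [norm_smul, e2basis_norm, mul_one, Real.norm_of_nonneg χ.nonneg]
  have key : ∀ F : E2 → ℝ, Continuous F → (∀ x, u x = 0 → F x = 0) →
      Integrable F ∧ HasCompactSupport F := by
    intro F hF h0
    have : HasCompactSupport F := hus.mono fun x hx => by
      rw [Function.mem_support] at hx ⊢
      exact fun h => hx (h0 x h)
    exact ⟨hF.integrable_of_hasCompactSupport this, this⟩
  have iA : Integrable (gradSq u) := (gradSq_cont hu).integrable_of_hasCompactSupport
    (gradSq_supp hus)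
  have iB := key (fun x => μ x * ‖u x‖^2) (by fun_prop) (fun x hx => by simp [hx])
  have iD := key (fun x => ‖u x‖^4) (by fun_prop) (fun x hx => by simp [hx])
  have iF := key (fun x => inner ℝ (f x) (u x)) (by fun_prop) (fun x hx => by simp [hx])
  set A := ∫ x, gradSq u x with hA
  set B := ∫ x, μ x * ‖u x‖^2 with hB
  set D := ∫ x, ‖u x‖^4 with hD
  set F := ∫ x, (inner ℝ (f x) (u x) : ℝ) with hF
  have hApos : 0 ≤ A := integral_nonneg fun x => by unfold gradSq; positivity
  have hDpos : 0 ≤ D := integral_nonneg fun x => by positivity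
  have hBpos : 0 < B := by
    refine Continuous.integral_pos_of_hasCompactSupport_nonneg_nonzero (x := 0) (by fun_prop)
      iB.2 ?_ ?_
    · intro x
      by_cases hx : x ∈ Metric.closedBall (0:E2) ρ0
      · have := hmge x hx
        have : 0 ≤ μ x := by linarith
        simp only [Pi.zero_apply]
        positivity
      · have : χ x = 0 := χ.zero_of_le_dist (by simpa using (not_le.1 (by simpa using hx)).le)
        simp [nu, this]
    · have h2 : 0 < μ 0 := by linarith [hmge 0 (by simp [h0.le])]
      have : χ (0:E2) = 1 := χ.one_of_mem_closedBall (Metric.mem_closedBall_self χ.rIn_pos.le)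
      rw [nu, this]
      simpa using h2.ne'
  obtain ⟨t, ht0, htD⟩ : ∃ t : ℝ, 0 < t ∧ t^2 * D ≤ B := by
    refine ⟨√(B / (D+1)), by positivity, ?_⟩
    rw [Real.sq_sqrt (by positivity), div_mul_eq_mul_div, div_le_iff₀ (by positivity)]
    nlinarith
  refine ⟨√(B / (2*(A+1))), by positivity, fun ε a v hε hε1 hm => ?_⟩
  have hε2 : ε^2 * (2*(A+1)) < B := by
    have := (Real.lt_sqrt hε.le).1 hε1
    rwa [lt_div_iff₀ (by positivity)] at this
  have hen : ∀ s : ℝ, energy ε a μ f (fun x => s • u x) = s^2 * A / 2 - s^2 * B / (2*ε^2)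
      + s^4 * D / (4*ε^2) - (a/ε) * s * F := by
    intro s
    rw [energy_eq]
    have : ∀ x, dens ε a μ f (fun x => s • u x) x = s^2/2 * gradSq u x
        + (-(s^2/(2*ε^2))) * (μ x * ‖u x‖^2) + s^4/(4*ε^2) * ‖u x‖^4
        + (-((a/ε) * s)) * inner ℝ (f x) (u x) := by
      intro x
      have e : gradSq (fun x => s • u x) x = s^2 * gradSq u x := by
        have hd : DifferentiableAt ℝ u x := hu.differentiable (by norm_num) x
        unfold gradSq
        rw [fderiv_fun_const_smul hd, Finset.mul_sum]
        refine Finset.sum_congr rfl fun i _ => ?_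
        rw [smul_apply, norm_smul, mul_pow]; simp
      unfold dens
      rw [e, norm_smul, inner_smul_right, mul_pow, mul_pow]
      have : ‖s‖^4 = s^4 := by
        rw [Real.norm_eq_abs, show |s|^4 = (|s|^2)^2 by ring, sq_abs]; ring
      rw [this]
      simp
      ring
    simp_rw [this]
    rw [(int_comb4 iA iB.1 iD.1 iF.1 (s^2/2) (-(s^2/(2*ε^2))) (s^4/(4*ε^2)) (-((a/ε) * s))).2]
    ring
  have hneg : ∃ s : ℝ, energy ε a μ f (fun x => s • u x) < 0 := by
    have hmain : t^2 * A / 2 - t^2 * B / (2*ε^2) + t^4 * D / (4*ε^2) < 0 := by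
      have e : t^2 * A / 2 - t^2 * B / (2*ε^2) + t^4 * D / (4*ε^2)
        = t^2 * (2 * ε^2 * A - 2 * B + t^2 * D) / (4*ε^2) := by field_simp; ring
      rw [e]
      apply div_neg_of_neg_of_pos _ (by positivity)
      apply mul_neg_of_pos_of_neg (by positivity)
      nlinarith [sq_nonneg ε]
    rcases le_total 0 ((a/ε) * t * F) with hF0 | hF0
    · exact ⟨t, by rw [hen]; linarith⟩
    · refine ⟨-t, ?_⟩
      rw [hen]
      have e1 : (-t)^2 = t^2 := by ring
      have e2 : (-t)^4 = t^4 := by ring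
      rw [e1, e2]
      linarith
  obtain ⟨s, hs⟩ := hneg
  have hs' : HasCompactSupport (fun x => s • u x) :=
    hus.mono fun x hx => by
      rw [Function.mem_support] at hx ⊢
      intro h0
      exact hx (by rw [h0, smul_zero])
  have h' : ContDiff ℝ 1 (fun x => s • u x) := by fun_prop
  have hle := (hm.2 _ (memH1_smooth h' hs')).trans_lt hs
  by_contra hni
  rw [energy_eq, integral_undef hni] at hle
  exact lt_irrefl _ hle


/-- Convolution of two scalar functions on the plane. -/
def cv (κ w : E2 → ℝ) (x : E2) : ℝ :=
  MeasureTheory.convolution κ w (ContinuousLinearMap.lsmul ℝ ℝ) volume x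

lemma cv_swap (κ w : E2 → ℝ) (x : E2) : cv κ w x = ∫ y, w y * κ (x - y) := by
  unfold cv
  rw [convolution_eq_swap]
  refine integral_congr_ae (Eventually.of_forall fun y => ?_)
  simp [mul_comm]

lemma cv_hasFDerivAt {κ w : E2 → ℝ} (hκ : ContDiff ℝ 1 κ) (hs : HasCompactSupport κ)
    (hw : Continuous w) (x : E2) :
    ∃ L : E2 →L[ℝ] ℝ, HasFDerivAt (cv κ w) L x ∧ ∀ e, L e = cv (fun y => fderiv ℝ κ y e) w x := by
  refine ⟨_, hs.hasFDerivAt_convolution_left (ContinuousLinearMap.lsmul ℝ ℝ) hκ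
    hw.locallyIntegrable x, fun e => ?_⟩
  have hex := (hs.fderiv (𝕜 := ℝ)).convolutionExists_left
    ((ContinuousLinearMap.lsmul ℝ ℝ).precompL E2) (hκ.continuous_fderiv (by norm_num))
    (hw.locallyIntegrable (μ := (volume : Measure E2))) x
  unfold cv
  rw [convolution_def, convolution_def, ContinuousLinearMap.integral_apply hex]
  rfl

lemma cv_deriv {κ w : E2 → ℝ} (hκ : ContDiff ℝ 1 κ) (hs : HasCompactSupport κ)
    (hw : Continuous w) (p e : E2) (s : ℝ) :
    HasDerivAt (fun s : ℝ => cv κ w (p + s • e)) (cv (fun y => fderiv ℝ κ y e) w (p + s • e)) s := by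
  obtain ⟨L, hL, he⟩ := cv_hasFDerivAt hκ hs hw (p + s • e)
  rw [← he]
  have h1 : HasDerivAt (fun s : ℝ => p + s • e) e s := by
    simpa using ((hasDerivAt_id s).smul_const e).const_add p
  exact hL.comp_hasDerivAt s h1

lemma cv_continuous {κ w : E2 → ℝ} (hκ : ContDiff ℝ 1 κ) (hs : HasCompactSupport κ)
    (hw : Continuous w) : Continuous (cv κ w) := by
  refine continuous_iff_continuousAt.2 fun x => ?_
  obtain ⟨L, hL, he⟩ := cv_hasFDerivAt hκ hs hw x
  exact hL.continuousAt

lemma cv_bound (φ : ContDiffBump (0:E2)) {w : E2 → ℝ} (hw : Continuous w) {x : E2} {M : ℝ}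
    (h : ∀ y ∈ Metric.closedBall x φ.rOut, |w y| ≤ M) : |cv (φ.normed volume) w x| ≤ 3 * M := by
  have h0 := h x (Metric.mem_closedBall_self φ.rOut_pos.le)
  have := φ.dist_normed_convolution_le (μ := (volume : Measure E2)) (g := w) (x₀ := x) (ε := 2 * M)
    hw.aestronglyMeasurable (fun y hy => by
      rw [Real.dist_eq]
      have := h y (Metric.ball_subset_closedBall hy)
      rw [abs_le] at *
      constructor <;> linarith [this.1, this.2, h0.1, h0.2])
  rw [Real.dist_eq] at this
  unfold cv
  rw [abs_le] at *
  constructor <;> linarith [this.1, this.2, h0.1, h0.2]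

lemma fderiv_coord {v : E2 → E2} {x : E2} (h : DifferentiableAt ℝ v x) (i : Fin 2) (e : E2) :
    fderiv ℝ (fun y => v y i) x e = (fderiv ℝ v x e) i := by
  have := ((EuclideanSpace.proj i : E2 →L[ℝ] ℝ).hasFDerivAt.comp x h.hasFDerivAt).fderiv
  have h2 : fderiv ℝ (fun y => v y i) x = _ := this
  rw [h2]
  rfl

lemma inner_e2basis (p : E2) (i : Fin 2) : inner ℝ p (e2basis i) = p i := by
  simp [e2basis, EuclideanSpace.inner_single_right]

lemma fderiv_refl {κ : E2 → ℝ} (hκ : Differentiable ℝ κ) (x y e : E2) :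
    fderiv ℝ (fun y => κ (x - y)) y e = - fderiv ℝ κ (x - y) e := by
  have h1 : HasFDerivAt (fun y : E2 => x - y) (-ContinuousLinearMap.id ℝ E2) y :=
    (hasFDerivAt_id y).const_sub x
  have h2 := ((hκ (x - y)).hasFDerivAt.comp y h1).fderiv
  have h3 : fderiv ℝ (fun y => κ (x - y)) y = _ := h2
  rw [h3]
  simp

lemma supp_refl {κ : E2 → ℝ} (h : HasCompactSupport κ) (x : E2) :
    HasCompactSupport (fun y => κ (x - y)) :=
  h.comp_homeomorph (Homeomorph.subLeft x)

/-- Weak Laplacian identity for a test kernel. -/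
lemma cv_lap {ε a : ℝ} {μ : E2 → ℝ} {f v : E2 → E2} (hε : 0 < ε) (hμ : Continuous μ)
    (hf : Continuous f) (hm : IsMinimizer ε a μ f v) (hi : Integrable (dens ε a μ f v))
    {κ : E2 → ℝ} (hκ : ContDiff ℝ 2 κ) (hs : HasCompactSupport κ) (x : E2) (i : Fin 2) :
    ∑ j : Fin 2, cv (fun y => fderiv ℝ (fun z => fderiv ℝ κ z (e2basis j)) y (e2basis j))
      (fun y => v y i) x = - cv κ (fun y => gEL ε a μ f v y i) x := by
  have hκd : Differentiable ℝ κ := hκ.differentiable (by norm_num)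
  have hk1 : ContDiff ℝ 1 κ := hκ.of_le (by norm_num)
  have hvc := hm.1.1.continuous
  have hD : ∀ j, ContDiff ℝ 1 (fun z => fderiv ℝ κ z (e2basis j)) := fun j =>
    (hκ.fderiv_right (m := 1) (by norm_num)).clm_apply contDiff_const
  have hDs : ∀ j, HasCompactSupport (fun z => fderiv ℝ κ z (e2basis j)) := fun j =>
    hs.fderiv_apply (𝕜 := ℝ) (e2basis j)
  set ψ : E2 → E2 := fun y => κ (x - y) • e2basis i with hψ
  have hψ1 : ContDiff ℝ 1 ψ := by
    have : ContDiff ℝ 1 (fun y : E2 => κ (x - y)) := hk1.comp (contDiff_const.sub contDiff_id)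
    fun_prop
  have hψs : HasCompactSupport ψ := (supp_refl hs x).smul_right
  have hEL := weak_EL hε hμ hf hm hi hψ1 hψs
  have gradψ : ∀ y j, fderiv ℝ ψ y (e2basis j) =
      (- fderiv ℝ κ (x - y) (e2basis j)) • e2basis i := by
    intro y j
    have hd : DifferentiableAt ℝ (fun y : E2 => κ (x - y)) y :=
      (hκd (x - y)).comp y ((differentiableAt_const x).sub differentiableAt_id)
    have := (hd.hasFDerivAt.smul_const (e2basis i)).fderiv
    have h2 : fderiv ℝ ψ y = _ := this
    rw [h2, ContinuousLinearMap.smulRight_apply, fderiv_refl hκd]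
  have e1 : ∀ y, gradInner v ψ y = - ∑ j : Fin 2, fderiv ℝ (fun y => v y i) y (e2basis j)
      * fderiv ℝ κ (x - y) (e2basis j) := by
    intro y
    unfold gradInner
    rw [← Finset.sum_neg_distrib]
    refine Finset.sum_congr rfl fun j _ => ?_
    rw [gradψ, inner_smul_right, inner_e2basis, fderiv_coord (hm.1.1 y)]
    ring
  have hcoord : Differentiable ℝ (fun y => v y i) := fun y =>
    (EuclideanSpace.proj i : E2 →L[ℝ] ℝ).differentiableAt.comp y (hm.1.1 y)
  have hL : LocallyIntegrable (fun y => fderiv ℝ v y) (volume : Measure E2) :=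
    hm.1.2.2.locallyIntegrable (by norm_num)
  have int1 : ∀ j, Integrable (fun y => fderiv ℝ (fun y => v y i) y (e2basis j)
      * fderiv ℝ κ (x - y) (e2basis j)) := by
    intro j
    have hc : Continuous fun y => fderiv ℝ κ (x - y) (e2basis j) :=
      (hD j).continuous.comp (continuous_const.sub continuous_id)
    have hcs : HasCompactSupport fun y => fderiv ℝ κ (x - y) (e2basis j) := supp_refl (hDs j) x
    have h1 := hL.integrable_smul_left_of_hasCompactSupport hc hcs
    have h2 := (h1.apply_continuousLinearMap (e2basis j))
    have h3 := (EuclideanSpace.proj i : E2 →L[ℝ] ℝ).integrable_comp h2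
    refine h3.congr (Eventually.of_forall fun y => ?_)
    simp only [fderiv_coord (hm.1.1 y), smul_apply]
    simp [mul_comm]
  have ibp : ∀ j, ∫ y, fderiv ℝ (fun y => v y i) y (e2basis j)
      * fderiv ℝ κ (x - y) (e2basis j) =
      cv (fun y => fderiv ℝ (fun z => fderiv ℝ κ z (e2basis j)) y (e2basis j))
      (fun y => v y i) x := by
    intro j
    have hgd : Differentiable ℝ (fun z => fderiv ℝ κ z (e2basis j)) :=
      (hD j).differentiable (by norm_num)
    have hc2 : Continuous fun y => fderiv ℝ (fun z => fderiv ℝ κ z (e2basis j)) y (e2basis j) :=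
      ((hD j).continuous_fderiv (by norm_num)).clm_apply continuous_const
    have hgr : ∀ y, fderiv ℝ (fun y => fderiv ℝ κ (x - y) (e2basis j)) y (e2basis j) =
        - fderiv ℝ (fun z => fderiv ℝ κ z (e2basis j)) (x - y) (e2basis j) := fun y =>
      fderiv_refl hgd x y _
    have hvi : Continuous (fun y => v y i) := hcoord.continuous
    have key := integral_mul_fderiv_eq_neg_fderiv_mul_of_integrable (μ := (volume : Measure E2))
      (f := fun y => v y i) (g := fun y => fderiv ℝ κ (x - y) (e2basis j)) (v := e2basis j)
      (int1 j) ?_ ?_ (fun y _ => hcoord y) (fun y _ => ?_)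
    · rw [← neg_eq_iff_eq_neg.2 key, cv_swap, ← integral_neg]
      refine integral_congr_ae (Eventually.of_forall fun y => ?_)
      simp only [hgr]
      ring
    · simp only [hgr]
      refine Continuous.integrable_of_hasCompactSupport ?_ ?_
      · exact hvi.mul (hc2.comp (continuous_const.sub continuous_id)).neg
      · have : HasCompactSupport fun y => 
          fderiv ℝ (fun z => fderiv ℝ κ z (e2basis j)) (x - y) (e2basis j) :=
          supp_refl ((hDs j).fderiv_apply (𝕜 := ℝ) (e2basis j)) x
        exact this.neg.mul_left
    · refine Continuous.integrable_of_hasCompactSupport ?_ ?_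
      · exact hvi.mul ((hD j).continuous.comp (continuous_const.sub continuous_id))
      · exact (supp_refl (hDs j) x).mul_left
    · exact (hgd (x - y)).comp y ((differentiableAt_const x).sub differentiableAt_id)
  have hgi : Integrable (fun y => gEL ε a μ f v y i * κ (x - y)) := by
    refine Continuous.integrable_of_hasCompactSupport ?_ ?_
    · have : Continuous (fun y => gEL ε a μ f v y) := by unfold gEL; fun_prop
      have h2 : Continuous fun y => gEL ε a μ f v y i :=
        (EuclideanSpace.proj i : E2 →L[ℝ] ℝ).continuous.comp this
      exact h2.mul (hk1.continuous.comp (continuous_const.sub continuous_id))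
    · exact (supp_refl hs x).mul_left
  have e2 : ∀ y, inner ℝ (gEL ε a μ f v y) (ψ y) = gEL ε a μ f v y i * κ (x - y) := by
    intro y
    simp only [hψ]
    rw [inner_smul_right, inner_e2basis, mul_comm]
  simp_rw [e1, e2] at hEL
  have hneg : Integrable (fun y => - ∑ j : Fin 2, fderiv ℝ (fun y => v y i) y (e2basis j)
      * fderiv ℝ κ (x - y) (e2basis j)) := (integrable_finsetSum _ fun j _ => int1 j).neg
  rw [integral_sub hneg hgi, integral_neg,
    integral_finsetSum _ (fun j _ => int1 j), ← cv_swap] at hEL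
  simp_rw [ibp] at hEL
  linarith

lemma opNorm_le_coord (L : E2 →L[ℝ] E2) {C : ℝ} (h : ∀ i j : Fin 2, |(L (e2basis j)) i| ≤ C) :
    ‖L‖ ≤ 4 * C := by
  have hC : 0 ≤ C := (abs_nonneg _).trans (h 0 0)
  have hj : ∀ j, ‖L (e2basis j)‖ ≤ 2 * C := by
    intro j
    rw [EuclideanSpace.norm_eq, Fin.sum_univ_two]
    refine Real.sqrt_le_iff.2 ⟨by positivity, ?_⟩
    have a1 := h 0 j
    have a2 := h 1 j
    simp only [Real.norm_eq_abs]
    nlinarith [abs_nonneg ((L (e2basis j)) 0), abs_nonneg ((L (e2basis j)) 1)]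
  refine L.opNorm_le_bound (by positivity) fun y => ?_
  have hy : y = y 0 • e2basis 0 + y 1 • e2basis 1 := by
    ext k; fin_cases k <;> simp [e2basis]
  have n0 : |y 0| ≤ ‖y‖ := PiLp.norm_apply_le y 0
  have n1 : |y 1| ≤ ‖y‖ := PiLp.norm_apply_le y 1
  conv_lhs => rw [hy, map_add, map_smul, map_smul]
  refine (norm_add_le _ _).trans ?_
  rw [norm_smul, norm_smul, Real.norm_eq_abs, Real.norm_eq_abs]
  nlinarith [mul_le_mul n0 (hj 0) (norm_nonneg _) (norm_nonneg _),
    mul_le_mul n1 (hj 1) (norm_nonneg _) (norm_nonneg _)]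

/-- Minimizers have locally bounded gradient. -/
lemma grad_bdd {ε a : ℝ} {μ : E2 → ℝ} {f v : E2 → E2} (hε : 0 < ε) (hμ : Continuous μ)
    (hf : Continuous f) (hm : IsMinimizer ε a μ f v) (hi : Integrable (dens ε a μ f v)) (R : ℝ) :
    ∃ L : ℝ, ∀ x : E2, ‖x‖ ≤ R → ‖fderiv ℝ v x‖ ≤ L := by
  have hvc := hm.1.1.continuous
  have hgc : Continuous (gEL ε a μ f v) := by unfold gEL; fun_prop
  obtain ⟨M, hM⟩ := (isCompact_closedBall (0:E2) (R+4)).exists_bound_of_continuousOn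
    hvc.continuousOn
  obtain ⟨N, hN⟩ := (isCompact_closedBall (0:E2) (R+4)).exists_bound_of_continuousOn
    hgc.continuousOn
  have hMi : ∀ i : Fin 2, ∀ x ∈ Metric.closedBall (0:E2) (R+4), |v x i| ≤ |M| := fun i x hx =>
    (PiLp.norm_apply_le (v x) i).trans ((hM x hx).trans (le_abs_self M))
  have hNi : ∀ i : Fin 2, ∀ x ∈ Metric.closedBall (0:E2) (R+4), |gEL ε a μ f v x i| ≤ |N| :=
    fun i x hx => (PiLp.norm_apply_le (gEL ε a μ f v x) i).trans ((hN x hx).trans (le_abs_self N))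
  have hpc : ∀ i : Fin 2, Continuous fun y : E2 => y i := fun i =>
    (EuclideanSpace.proj i : E2 →L[ℝ] ℝ).continuous
  set C := 2 * (2 * (3 * |M|) / 1 + (3 * |N| + 1) * 1 / 2) with hC
  have hCpos : 0 ≤ C := by positivity
  let φ : ℕ → ContDiffBump (0:E2) := fun n =>
    ⟨1/((n:ℝ)+2), 1/((n:ℝ)+1), by positivity, by
      apply one_div_lt_one_div_of_lt (by positivity); linarith⟩
  have hφ1 : ∀ n, (φ n).rOut ≤ 1 := fun n => by
    show 1/((n:ℝ)+1) ≤ 1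
    rw [div_le_one (by positivity)]
    linarith [(Nat.cast_nonneg n : (0:ℝ) ≤ n)]
  have hφ0 : Tendsto (fun n => (φ n).rOut) atTop (𝓝 0) := tendsto_one_div_add_atTop_nhds_zero_nat
  have main : ∀ x : E2, ‖x‖ ≤ R → ∀ i j : Fin 2, ∀ h : ℝ, 0 ≤ h → h ≤ 1 →
      |v (x + h • e2basis j) i - v (x + (-h) • e2basis j) i| ≤ C * h := by
    intro x hx i j h h0 h1
    have step : ∀ n, |cv ((φ n).normed volume) (fun y => v y i) (x + h • e2basis j)
        - cv ((φ n).normed volume) (fun y => v y i) (x + (-h) • e2basis j)| ≤ C * h := by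
      intro n
      set κ := (φ n).normed (volume : Measure E2) with hκdef
      have hκ : ContDiff ℝ 2 κ := (φ n).contDiff_normed (n := 2)
      have hκ1 : ContDiff ℝ 1 κ := hκ.of_le (by norm_num)
      have hs : HasCompactSupport κ := (φ n).hasCompactSupport_normed
      have hD : ∀ j, ContDiff ℝ 1 (fun z => fderiv ℝ κ z (e2basis j)) := fun j =>
        (hκ.fderiv_right (m := 1) (by norm_num)).clm_apply contDiff_const
      have hDs : ∀ j, HasCompactSupport (fun z => fderiv ℝ κ z (e2basis j)) := fun j =>
        hs.fderiv_apply (𝕜 := ℝ) (e2basis j)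
      set w : E2 → ℝ := fun y => v y i with hw
      have hwc : Continuous w := (hpc i).comp hvc
      obtain ⟨k, hk⟩ : ∃ k : Fin 2, ∀ F : Fin 2 → ℝ, F k + F j = ∑ l : Fin 2, F l := by
        fin_cases j
        · exact ⟨1, fun F => by rw [Fin.sum_univ_two]; exact add_comm _ _⟩
        · exact ⟨0, fun F => by rw [Fin.sum_univ_two]; rfl⟩
      have hball : ∀ s t : ℝ, |s| ≤ 1 → |t| ≤ 1 →
          ∀ y ∈ Metric.closedBall (x + s • e2basis k + t • e2basis j) (φ n).rOut,
            y ∈ Metric.closedBall (0:E2) (R+4) := by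
        intro s t hs ht y hy
        rw [mem_closedBall_zero_iff]
        rw [mem_closedBall_iff_norm] at hy
        have t1 : ‖s • e2basis k‖ ≤ 1 := by rw [norm_smul, e2basis_norm, mul_one]; exact hs
        have t2 : ‖t • e2basis j‖ ≤ 1 := by rw [norm_smul, e2basis_norm, mul_one]; exact ht
        have t3 := norm_add₃_le (a := x) (b := s • e2basis k) (c := t • e2basis j)
        have t4 := norm_le_insert' y (x + s • e2basis k + t • e2basis j)
        linarith [hφ1 n]
      have swap : ∀ s t : ℝ, x + s • e2basis k + t • e2basis j
          = x + t • e2basis j + s • e2basis k := fun s t => by abel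
      have := grad_est (d := 1) (M := 3 * |M|) (N := 3 * |N|) one_pos (by positivity)
        (by positivity)
        (fun s t => cv κ w (x + s • e2basis k + t • e2basis j))
        (fun s t => cv (fun z => fderiv ℝ κ z (e2basis k)) w (x + s • e2basis k + t • e2basis j))
        (fun s t => cv (fun y => fderiv ℝ (fun z => fderiv ℝ κ z (e2basis k)) y (e2basis k)) w
          (x + s • e2basis k + t • e2basis j))
        (fun s t => cv (fun z => fderiv ℝ κ z (e2basis j)) w (x + s • e2basis k + t • e2basis j))
        (fun s t => cv (fun y => fderiv ℝ (fun z => fderiv ℝ κ z (e2basis j)) y (e2basis j)) w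
          (x + s • e2basis k + t • e2basis j)) ?_ ?_ ?_ ?_ ?_ ?_ ?_ h h0 h1
      · simpa [hC] using this
      · have := cv_continuous hκ1 hs hwc
        simp only [Function.uncurry_def]
        fun_prop
      · intro s t
        simp only [swap]
        exact cv_deriv hκ1 hs hwc _ _ _
      · intro s t
        simp only [swap]
        exact cv_deriv (hD k) (hDs k) hwc _ _ _
      · intro s t
        exact cv_deriv hκ1 hs hwc _ _ _
      · intro s t
        exact cv_deriv (hD j) (hDs j) hwc _ _ _
      · intro s t hs ht
        exact cv_bound (φ n) hwc fun y hy => hMi i y (hball s t hs ht y hy)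
      · intro s t hs' ht
        have e := cv_lap hε hμ hf hm hi hκ hs (x + s • e2basis k + t • e2basis j) i
        have e2 := hk (fun l => cv (fun y => fderiv ℝ (fun z => fderiv ℝ κ z (e2basis l)) y
          (e2basis l)) w (x + s • e2basis k + t • e2basis j))
        rw [e2, e, abs_neg]
        exact cv_bound (φ n) ((hpc i).comp hgc) fun y hy => hNi i y (hball s t hs' ht y hy)
    have lim : ∀ y, Tendsto (fun n => cv ((φ n).normed volume) (fun y => v y i) y) atTop
        (𝓝 (v y i)) := fun y =>
      ContDiffBump.convolution_tendsto_right_of_continuous hφ0 ((hpc i).comp hvc) y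
    exact le_of_tendsto ((lim _).sub (lim _)).abs (Eventually.of_forall step)
  refine ⟨4 * C, fun x hx => opNorm_le_coord _ fun i j => ?_⟩
  have hd : HasDerivAt (fun h : ℝ => v (x + h • e2basis j) i - v (x + (-h) • e2basis j) i)
      (2 * (fderiv ℝ v x (e2basis j)) i) 0 := by
    have h1 : ∀ c : ℝ, HasDerivAt (fun h : ℝ => v (x + (c * h) • e2basis j) i)
      (c * (fderiv ℝ v x (e2basis j)) i) 0 := by
      intro c
      have b1 : HasDerivAt (fun h : ℝ => x + (c * h) • e2basis j) (c • e2basis j) 0 := by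
        simpa using (((hasDerivAt_id (0:ℝ)).const_mul c).smul_const (e2basis j)).const_add x
      have b2 : HasFDerivAt v (fderiv ℝ v x) (x + (c * 0) • e2basis j) := by
        simpa using (hm.1.1 x).hasFDerivAt
      have b3 := (EuclideanSpace.proj i : E2 →L[ℝ] ℝ).hasFDerivAt.comp_hasDerivAt
        (0:ℝ) (b2.comp_hasDerivAt (0:ℝ) b1)
      refine HasDerivAt.congr_deriv b3 ?_
      simp
    have h2 := (h1 1).sub (h1 (-1))
    refine HasDerivAt.congr_deriv (f' := _) (h2.congr_of_eventuallyEq ?_) ?_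
    · refine Eventually.of_forall fun h => ?_
      simp
    · ring
  have hlip := hd.le_of_lip' (C := C) hCpos (by
    filter_upwards [Icc_mem_nhds (show (-1:ℝ) < 0 by norm_num) (show (0:ℝ) < 1 by norm_num)] with h hh
    simp only [neg_zero, zero_smul, sub_self, sub_zero, Real.norm_eq_abs]
    rcases le_total 0 h with h0 | h0
    · rw [abs_of_nonneg h0]
      exact main x hx i j h h0 hh.2
    · rw [abs_of_nonpos h0, abs_sub_comm]
      have := main x hx i j (-h) (by linarith) (by linarith [hh.1])
      rwa [neg_neg] at this)
  rw [Real.norm_eq_abs, abs_mul, abs_of_pos (by norm_num : (0:ℝ) < 2)] at hlip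
  linarith [abs_nonneg ((fderiv ℝ v x (e2basis j)) i)]


lemma gradSq_le (u : E2 → E2) (x : E2) {A : ℝ} (h : ‖fderiv ℝ u x‖ ≤ A) :
    gradSq u x ≤ 2 * A^2 := by
  unfold gradSq
  rw [Fin.sum_univ_two]
  have : ∀ i, ‖fderiv ℝ u x (e2basis i)‖ ≤ A := fun i => by
    have := (fderiv ℝ u x).le_opNorm (e2basis i)
    rw [e2basis_norm, mul_one] at this
    exact this.trans h
  nlinarith [this 0, this 1, norm_nonneg (fderiv ℝ u x (e2basis 0)),
    norm_nonneg (fderiv ℝ u x (e2basis 1))]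

lemma gradSq_nonneg (u : E2 → E2) (x : E2) : 0 ≤ gradSq u x := by
  unfold gradSq; positivity

lemma dens_bound {ε a : ℝ} {μ : E2 → ℝ} {f u : E2 → E2} (hε : 0 < ε) {x : E2} {A B m F : ℝ}
    (hA : ‖fderiv ℝ u x‖ ≤ A) (hB : ‖u x‖ ≤ B) (hm : |μ x| ≤ m) (hF : ‖f x‖ ≤ F) :
    |dens ε a μ f u x| ≤ A^2 + (1/(2*ε^2)) * m * B^2 + (1/(4*ε^2)) * B^4 + |a/ε| * (F * B) := by
  have h1 := gradSq_le u x hA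
  have h0 := gradSq_nonneg u x
  have h2 : |(1/(2*ε^2)) * μ x * ‖u x‖^2| ≤ (1/(2*ε^2)) * m * B^2 := by
    rw [abs_mul, abs_mul, abs_of_nonneg (by positivity : 0 ≤ 1/(2*ε^2)),
      abs_of_nonneg (by positivity : 0 ≤ ‖u x‖^2)]
    have : 0 ≤ m := (abs_nonneg _).trans hm
    gcongr
  have h3 : (1/(4*ε^2)) * ‖u x‖^4 ≤ (1/(4*ε^2)) * B^4 := by gcongr
  have h3' : 0 ≤ (1/(4*ε^2)) * ‖u x‖^4 := by positivity
  have h4 : |(a/ε) * inner ℝ (f x) (u x)| ≤ |a/ε| * (F * B) := by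
    rw [abs_mul]
    have := abs_real_inner_le_norm (f x) (u x)
    have h5 : ‖f x‖ * ‖u x‖ ≤ F * B :=
      mul_le_mul hF hB (norm_nonneg _) ((norm_nonneg _).trans hF)
    gcongr
    exact this.trans h5
  unfold dens
  rw [abs_le] at *
  constructor <;> linarith [h2.1, h2.2, h4.1, h4.2]

lemma dens_congr {ε a : ℝ} {μ : E2 → ℝ} {f u w : E2 → E2} {x : E2} (h : u =ᶠ[𝓝 x] w) :
    dens ε a μ f u x = dens ε a μ f w x := by
  unfold dens gradSq
  rw [h.fderiv_eq, h.eq_of_nhds]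

lemma gradSq_meas (u : E2 → E2) : Measurable (gradSq u) := by
  unfold gradSq
  refine Finset.measurable_sum _ fun i _ => ?_
  exact ((measurable_fderiv_apply_const ℝ u (e2basis i)).norm).pow_const 2

lemma dens_meas {ε a : ℝ} {μ : E2 → ℝ} {f u : E2 → E2} (hμ : Continuous μ) (hf : Continuous f)
    (hu : Continuous u) : Measurable (dens ε a μ f u) := by
  have h1 : Measurable fun x => (1/2) * gradSq u x := (gradSq_meas u).const_mul _
  have h2 : Measurable fun x => (1/(2*ε^2)) * μ x * ‖u x‖^2 := Continuous.measurable (by fun_prop)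
  have h3 : Measurable fun x => (1/(4*ε^2)) * ‖u x‖^4 := Continuous.measurable (by fun_prop)
  have h4 : Measurable fun x => (a/ε) * (inner ℝ (f x) (u x) : ℝ) :=
    Continuous.measurable (by fun_prop)
  exact ((h1.sub h2).add h3).sub h4

lemma moll_hasFDerivAt (φ : ContDiffBump (0:E2)) {ψ : E2 → E2} {L : NNReal}
    (hψ : LipschitzWith L ψ) (x : E2) :
    HasFDerivAt (MeasureTheory.convolution (φ.normed volume) ψ (ContinuousLinearMap.lsmul ℝ ℝ) volume)
      (MeasureTheory.convolution (φ.normed volume) (fderiv ℝ ψ) (ContinuousLinearMap.lsmul ℝ ℝ)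
        volume x) x := by
  have hη := φ.continuous_normed (μ := (volume : Measure E2))
  have hηs := φ.hasCompactSupport_normed (μ := (volume : Measure E2))
  have key := hasFDerivAt_integral_of_dominated_loc_of_lip (𝕜 := ℝ) (μ := (volume : Measure E2))
    (F := fun x t => φ.normed volume t • ψ (x - t)) (x₀ := x) (s := univ)
    (F' := fun t => φ.normed volume t • fderiv ℝ ψ (x - t))
    (bound := fun t => φ.normed volume t * L) univ_mem
    (Eventually.of_forall fun z => ?_) ?_ ?_ ?_ ?_ ?_
  · have h2 := key.2
    exact h2
  · have : Continuous fun t => φ.normed volume t • ψ (z - t) := by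
      have := hψ.continuous; fun_prop
    exact this.aestronglyMeasurable
  · have : Continuous fun t => φ.normed volume t • ψ (x - t) := by
      have := hψ.continuous; fun_prop
    exact this.integrable_of_hasCompactSupport hηs.smul_right
  · have : Measurable fun t => φ.normed volume t • fderiv ℝ ψ (x - t) :=
      hη.measurable.smul ((measurable_fderiv ℝ ψ).comp (measurable_const.sub measurable_id))
    exact this.aestronglyMeasurable
  · refine Eventually.of_forall fun t => ?_
    refine LipschitzOnWith.of_dist_le_mul fun p _ q _ => ?_
    have n0 := φ.nonneg_normed (μ := (volume : Measure E2)) t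
    rw [dist_eq_norm, ← smul_sub, norm_smul, Real.norm_of_nonneg n0]
    have := hψ.dist_le_mul (p - t) (q - t)
    rw [dist_sub_right, dist_eq_norm] at this
    simp only [Real.coe_nnabs, abs_mul, abs_of_nonneg n0, NNReal.abs_eq]
    rw [mul_assoc]
    gcongr
  · exact φ.integrable_normed.mul_const _
  · have h0 := hψ.ae_differentiableAt (μ := (volume : Measure E2))
    have h1 := (quasiMeasurePreserving_sub_left (volume : Measure E2) x).ae h0
    filter_upwards [h1] with t ht
    have h2 : HasFDerivAt (fun z : E2 => z - t) (ContinuousLinearMap.id ℝ E2) x :=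
      (hasFDerivAt_id x).sub_const t
    have h3 := ht.hasFDerivAt.comp x h2
    exact h3.const_smul (φ.normed volume t)

lemma moll_norm_le (φ : ContDiffBump (0:E2)) {F : Type*} [NormedAddCommGroup F] [NormedSpace ℝ F]
    {g : E2 → F} {M : ℝ} (h : ∀ x, ‖g x‖ ≤ M) (x : E2) :
    ‖MeasureTheory.convolution (φ.normed volume) g (ContinuousLinearMap.lsmul ℝ ℝ) volume x‖ ≤ M := by
  have : ‖MeasureTheory.convolution (φ.normed volume) g (ContinuousLinearMap.lsmul ℝ ℝ) volume x‖
      ≤ ∫ t, φ.normed volume t * M := by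
    refine norm_integral_le_of_norm_le (φ.integrable_normed.mul_const M)
      (Eventually.of_forall fun t => ?_)
    have n0 := φ.nonneg_normed (μ := (volume : Measure E2)) t
    rw [ContinuousLinearMap.lsmul_apply, norm_smul, Real.norm_of_nonneg n0]
    exact mul_le_mul_of_nonneg_left (h _) n0
  rwa [integral_mul_const, φ.integral_normed, one_mul] at this

lemma moll_supp (φ : ContDiffBump (0:E2)) (h1 : φ.rOut ≤ 1) {ψ : E2 → E2} {R : ℝ}
    (hs : ∀ x, R ≤ ‖x‖ → ψ x = 0) (x : E2) (hx : R + 1 ≤ ‖x‖) :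
    MeasureTheory.convolution (φ.normed volume) ψ (ContinuousLinearMap.lsmul ℝ ℝ) volume x = 0 := by
  unfold MeasureTheory.convolution
  refine integral_eq_zero_of_ae (Eventually.of_forall fun t => ?_)
  by_cases ht : ‖t‖ ≤ 1
  · have : ψ (x - t) = 0 := hs _ (by
      have := norm_sub_norm_le x t
      linarith)
    simp [this]
  · have : φ.normed volume t = 0 := by
      rw [← Function.notMem_support, φ.support_normed_eq, mem_ball_zero_iff]
      linarith
    simp [this]

/-- Energy comparison for Lipschitz compactly supported perturbations. -/
lemma compare_lip {ε a : ℝ} {μ : E2 → ℝ} {f v : E2 → E2} (hε : 0 < ε) (hμ : Continuous μ)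
    (hf : Continuous f) (hm : IsMinimizer ε a μ f v) (hi : Integrable (dens ε a μ f v))
    {ψ : E2 → E2} {L : NNReal} (hψ : LipschitzWith L ψ) {R : ℝ}
    (hs : ∀ x, R ≤ ‖x‖ → ψ x = 0) :
    0 ≤ ∫ x, (dens ε a μ f (fun x => v x + ψ x) x - dens ε a μ f v x) := by
  have hvc := hm.1.1.continuous
  obtain ⟨Lv, hLv⟩ := grad_bdd hε hμ hf hm hi (R+1)
  have hcpt := isCompact_closedBall (0:E2) (R+1)
  obtain ⟨Mv, hMv⟩ := hcpt.exists_bound_of_continuousOn hvc.continuousOn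
  obtain ⟨Mm, hMm⟩ := hcpt.exists_bound_of_continuousOn hμ.continuousOn
  obtain ⟨Mf, hMf⟩ := hcpt.exists_bound_of_continuousOn hf.continuousOn
  obtain ⟨Mψ, hMψ'⟩ := (isCompact_closedBall (0:E2) R).exists_bound_of_continuousOn
    hψ.continuous.continuousOn
  have hMψ : ∀ x, ‖ψ x‖ ≤ |Mψ| := fun x => by
    rcases le_total R ‖x‖ with h | h
    · rw [hs x h, norm_zero]; positivity
    · exact (hMψ' x (by simpa using h)).trans (le_abs_self _)
  have hDψ : ∀ x, ‖fderiv ℝ ψ x‖ ≤ L := fun x => norm_fderiv_le_of_lipschitz ℝ hψ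
  let φ : ℕ → ContDiffBump (0:E2) := fun n =>
    ⟨1/((n:ℝ)+2), 1/((n:ℝ)+1), by positivity, by
      apply one_div_lt_one_div_of_lt (by positivity); linarith⟩
  have hφ1 : ∀ n, (φ n).rOut ≤ 1 := fun n => by
    show 1/((n:ℝ)+1) ≤ 1
    rw [div_le_one (by positivity)]
    linarith [(Nat.cast_nonneg n : (0:ℝ) ≤ n)]
  have hφ0 : Tendsto (fun n => (φ n).rOut) atTop (𝓝 0) := tendsto_one_div_add_atTop_nhds_zero_nat
  have hφK : ∀ n, (φ n).rOut ≤ 2 * (φ n).rIn := fun n => by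
    show 1/((n:ℝ)+1) ≤ 2 * (1/((n:ℝ)+2))
    have : (0:ℝ) ≤ n := Nat.cast_nonneg n
    rw [mul_one_div, div_le_div_iff₀ (by positivity) (by positivity)]
    linarith
  set Ψ : ℕ → E2 → E2 := fun n => MeasureTheory.convolution ((φ n).normed volume) ψ
    (ContinuousLinearMap.lsmul ℝ ℝ) volume with hΨ
  have hΨd : ∀ n x, HasFDerivAt (Ψ n) (MeasureTheory.convolution ((φ n).normed volume)
    (fderiv ℝ ψ) (ContinuousLinearMap.lsmul ℝ ℝ) volume x) x := fun n x =>
    moll_hasFDerivAt (φ n) hψ x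
  have hΨs : ∀ n x, R + 1 ≤ ‖x‖ → Ψ n x = 0 := fun n x hx => moll_supp (φ n) (hφ1 n) hs x hx
  have hΨc : ∀ n, ContDiff ℝ 1 (Ψ n) := fun n =>
    (φ n).hasCompactSupport_normed.contDiff_convolution_left _ ((φ n).contDiff_normed (n := 1))
      hψ.continuous.locallyIntegrable
  have hΨcs : ∀ n, HasCompactSupport (Ψ n) := fun n =>
    HasCompactSupport.intro hcpt fun x hx => hΨs n x (by
      rw [mem_closedBall_zero_iff, not_le] at hx; exact hx.le)
  set B := (Lv + L)^2 + (1/(2*ε^2)) * Mm * (Mv+|Mψ|)^2 + (1/(4*ε^2)) * (Mv+|Mψ|)^4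
    + |a/ε| * (Mf * (Mv+|Mψ|)) with hB
  set B' := Lv^2 + (1/(2*ε^2)) * Mm * Mv^2 + (1/(4*ε^2)) * Mv^4 + |a/ε| * (Mf * Mv) with hB'
  set bd : E2 → ℝ := indicator (Metric.closedBall (0:E2) (R+1)) (fun _ => B + B') with hbd
  have hbdi : Integrable bd := by
    rw [hbd, integrable_indicator_iff hcpt.measurableSet]
    exact integrableOn_const hcpt.measure_lt_top.ne
  have hFbd : ∀ n x, ‖dens ε a μ f (fun x => v x + Ψ n x) x - dens ε a μ f v x‖ ≤ bd x := by
    intro n x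
    by_cases hx : x ∈ Metric.closedBall (0:E2) (R+1)
    · rw [hbd, indicator_of_mem hx]
      have hx' : ‖x‖ ≤ R + 1 := by simpa using hx
      refine (norm_sub_le _ _).trans (add_le_add ?_ ?_)
      · refine dens_bound hε ?_ ((norm_add_le _ _).trans (add_le_add (hMv x hx) ?_)) (hMm x hx)
          (hMf x hx)
        · have : fderiv ℝ (fun x => v x + Ψ n x) x = _ :=
            ((hm.1.1 x).hasFDerivAt.add (hΨd n x)).fderiv
          rw [this]
          exact (norm_add_le _ _).trans (add_le_add (hLv x hx') (moll_norm_le (φ n) hDψ x))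
        · exact moll_norm_le (φ n) hMψ x
      · exact dens_bound hε (hLv x hx') (hMv x hx) (hMm x hx) (hMf x hx)
    · rw [hbd, indicator_of_notMem hx]
      have hev : (fun x => v x + Ψ n x) =ᶠ[𝓝 x] v := by
        filter_upwards [Metric.isClosed_closedBall.isOpen_compl.mem_nhds hx] with y hy
        rw [mem_compl_iff, mem_closedBall_zero_iff, not_le] at hy
        rw [hΨs n y hy.le, add_zero]
      rw [dens_congr hev, sub_self, norm_zero]
  have hFm : ∀ n, AEStronglyMeasurable
      (fun x => dens ε a μ f (fun x => v x + Ψ n x) x - dens ε a μ f v x) volume := fun n =>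
    ((dens_meas hμ hf (hvc.add (hΨc n).continuous)).sub
      (dens_meas hμ hf hvc)).aestronglyMeasurable
  have hFn : ∀ n, 0 ≤ ∫ x, (dens ε a μ f (fun x => v x + Ψ n x) x - dens ε a μ f v x) := by
    intro n
    have i1 : Integrable (fun x => dens ε a μ f (fun x => v x + Ψ n x) x - dens ε a μ f v x) :=
      hbdi.mono' (hFm n) (Eventually.of_forall (hFbd n))
    have i2 : Integrable (dens ε a μ f (fun x => v x + Ψ n x)) := by
      refine (i1.add hi).congr (Eventually.of_forall fun x => ?_)
      simp
    have hle := hm.2 (fun x => v x + Ψ n x) (memH1_add_smooth hm.1 (hΨc n) (hΨcs n))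
    rw [energy_eq, energy_eq] at hle
    rw [integral_sub i2 hi]
    linarith
  have hDloc : LocallyIntegrable (fderiv ℝ ψ) (volume : Measure E2) := by
    intro x
    refine ⟨Metric.closedBall x 1, Metric.closedBall_mem_nhds x one_pos, ?_⟩
    refine Measure.integrableOn_of_bounded (M := L)
      (isCompact_closedBall x 1).measure_lt_top.ne
      (measurable_fderiv ℝ ψ).aestronglyMeasurable (Eventually.of_forall fun y => hDψ y)
  have hlim := tendsto_integral_of_dominated_convergence
    (F := fun n x => dens ε a μ f (fun x => v x + Ψ n x) x - dens ε a μ f v x)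
    (f := fun x => dens ε a μ f (fun x => v x + ψ x) x - dens ε a μ f v x)
    (μ := (volume : Measure E2)) bd hFm hbdi
    (fun n => Eventually.of_forall (hFbd n)) (by
      filter_upwards [hψ.ae_differentiableAt (μ := (volume : Measure E2)),
        ContDiffBump.ae_convolution_tendsto_right_of_locallyIntegrable hφ0
          (Eventually.of_forall hφK) hDloc] with x hx hlx
      have hl0 : Tendsto (fun n => Ψ n x) atTop (𝓝 (ψ x)) :=
        ContDiffBump.convolution_tendsto_right_of_continuous hφ0 hψ.continuous x
      refine Tendsto.sub ?_ tendsto_const_nhds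
      have hu : Tendsto (fun n => v x + Ψ n x) atTop (𝓝 (v x + ψ x)) := tendsto_const_nhds.add hl0
      have hg : Tendsto (fun n => gradSq (fun x => v x + Ψ n x) x) atTop
          (𝓝 (gradSq (fun x => v x + ψ x) x)) := by
        have e1 : ∀ n, fderiv ℝ (fun x => v x + Ψ n x) x = _ := fun n =>
          ((hm.1.1 x).hasFDerivAt.add (hΨd n x)).fderiv
        have e2 : fderiv ℝ (fun x => v x + ψ x) x = _ :=
          ((hm.1.1 x).hasFDerivAt.add hx.hasFDerivAt).fderiv
        unfold gradSq
        simp_rw [e1, e2]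
        refine tendsto_finsetSum _ fun i _ => ?_
        refine Tendsto.pow (Tendsto.norm ?_) 2
        exact ((ContinuousLinearMap.apply ℝ E2 (e2basis i)).continuous.tendsto _).comp
          (tendsto_const_nhds.add hlx)
      unfold dens
      exact ((hg.const_mul _).sub ((hu.norm.pow 2).const_mul _)).add ((hu.norm.pow 4).const_mul _)
        |>.sub ((tendsto_const_nhds.inner hu).const_mul _))
  exact ge_of_tendsto hlim (Eventually.of_forall hFn)


lemma uvec_norm (θ : ℝ) : ‖uvec θ‖ = 1 := by
  rw [EuclideanSpace.norm_eq, Fin.sum_univ_two]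
  simp [uvec]

lemma uvec_cont : Continuous uvec := by
  unfold uvec
  have h : ∀ i : Fin 2, Continuous fun t : ℝ => (EuclideanSpace.single i t : E2) := fun i => by
    have : (fun t : ℝ => (EuclideanSpace.single i t : E2)) = fun t => t • e2basis i := by
      funext t; ext k; fin_cases k <;> fin_cases i <;> simp [e2basis]
    rw [this]; fun_prop
  exact ((h 0).comp continuous_cos).add ((h 1).comp continuous_sin)

lemma uvec_eq (θ : ℝ) : uvec θ = Real.cos θ • e2basis 0 + Real.sin θ • e2basis 1 := by
  ext k; fin_cases k <;> simp [uvec, e2basis]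

lemma uvec_hasDerivAt (θ : ℝ) :
    HasDerivAt uvec (-Real.sin θ • e2basis 0 + Real.cos θ • e2basis 1) θ := by
  have : uvec = fun θ => Real.cos θ • e2basis 0 + Real.sin θ • e2basis 1 := funext uvec_eq
  rw [this]
  exact ((hasDerivAt_cos θ).smul_const _).add ((hasDerivAt_sin θ).smul_const _)

lemma uvec_periodic : Function.Periodic uvec (2*π) := fun θ => by simp [uvec]

/-- The map from `ℝ × ℝ` to the Euclidean plane. -/
def toE (p : ℝ × ℝ) : E2 := p.1 • e2basis 0 + p.2 • e2basis 1

lemma integral_toE (g : E2 → ℝ) : ∫ x, g x = ∫ p : ℝ × ℝ, g (toE p) := by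
  have h1 := (EuclideanSpace.volume_preserving_symm_measurableEquiv_toLp (Fin 2)).symm
  have h2 := (volume_preserving_finTwoArrow ℝ).symm
  rw [← h1.integral_comp', ← h2.integral_comp']
  refine integral_congr_ae (Eventually.of_forall fun p => ?_)
  refine congrArg g ?_
  ext k; fin_cases k <;> simp [toE, e2basis, MeasurableEquiv.finTwoArrow]

/-- Integration of a zero-homogeneous function over a disc. -/
lemma polar_disc (x₀ : E2) {r : ℝ} (hr : 0 < r) (Φ : E2 → ℝ) :
    ∫ x in Metric.ball x₀ r, Φ (x₀ + (r/‖x - x₀‖) • (x - x₀))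
      = r^2/2 * ∫ θ in (0:ℝ)..(2*π), Φ (x₀ + r • uvec θ) := by
  rw [← integral_indicator Metric.isOpen_ball.measurableSet, ← integral_add_left_eq_self _ x₀,
    integral_toE, ← integral_comp_polarCoord_symm, polarCoord_target]
  have e : ∫ p in Ioi (0:ℝ) ×ˢ Ioo (-π) π, p.1 • (Metric.ball x₀ r).indicator
      (fun x => Φ (x₀ + (r/‖x - x₀‖) • (x - x₀))) (x₀ + toE (polarCoord.symm p)) =
      ∫ p in Ioi (0:ℝ) ×ˢ Ioo (-π) π, (Iio r).indicator id p.1 * Φ (x₀ + r • uvec p.2) := by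
    refine setIntegral_congr_fun (measurableSet_Ioi.prod measurableSet_Ioo) fun p hp => ?_
    have hp1 : 0 < p.1 := hp.1
    have e1 : toE (polarCoord.symm p) = p.1 • uvec p.2 := by
      rw [uvec_eq]
      simp [toE, polarCoord, smul_smul]
    have e2 : ‖p.1 • uvec p.2‖ = p.1 := by
      rw [norm_smul, uvec_norm, mul_one, Real.norm_of_nonneg hp1.le]
    simp only [e1]
    by_cases h : p.1 < r
    · rw [indicator_of_mem (by simpa [mem_ball_iff_norm, e2] using h), indicator_of_mem (by exact h)]
      rw [add_sub_cancel_left, e2, smul_smul, div_mul_cancel₀ _ hp1.ne']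
      simp
    · rw [indicator_of_notMem (by simpa [mem_ball_iff_norm, e2] using h),
        indicator_of_notMem (by exact h)]
      simp
  rw [e, show (volume : Measure (ℝ × ℝ)) = (volume : Measure ℝ).prod volume from rfl,
    setIntegral_prod_mul (fun t => (Iio r).indicator id t) (fun θ => Φ (x₀ + r • uvec θ))]
  congr 1
  · rw [setIntegral_indicator measurableSet_Iio]
    rw [show Ioi (0:ℝ) ∩ Iio r = Ioo 0 r from rfl, ← integral_Ioc_eq_integral_Ioo,
      ← intervalIntegral.integral_of_le hr.le]
    simp
  · rw [← integral_Ioc_eq_integral_Ioo, ← intervalIntegral.integral_of_le (by linarith [pi_pos])]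
    have hp : Function.Periodic (fun θ => Φ (x₀ + r • uvec θ)) (2*π) := fun θ => by
      simp only [uvec_periodic θ]
    have := hp.intervalIntegral_add_eq (-π) 0
    rw [show -π + 2*π = π by ring, zero_add] at this
    exact this

lemma exists_uvec {z x₀ : E2} {r : ℝ} (hr : 0 < r) (h : ‖z - x₀‖ = r) :
    ∃ θ ∈ Icc 0 (2*π), z = x₀ + r • uvec θ := by
  set y := r⁻¹ • (z - x₀) with hy
  have hn : ‖y‖ = 1 := by
    rw [hy, norm_smul, h, norm_inv, Real.norm_of_nonneg hr.le, inv_mul_cancel₀ hr.ne']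
  have hs : y 0 ^ 2 + y 1 ^ 2 = 1 := by
    have := EuclideanSpace.norm_sq_eq y
    rw [hn, Fin.sum_univ_two] at this
    simp at this; linarith
  let w : ℂ := ⟨y 0, y 1⟩
  have hw : ‖w‖ = 1 := by
    rw [← sq_eq_sq₀ (norm_nonneg _) zero_le_one, ← Complex.normSq_eq_norm_sq, Complex.normSq_mk]
    linarith
  have hw0 : w ≠ 0 := fun h0 => by rw [h0, norm_zero] at hw; exact zero_ne_one hw
  have hc : Real.cos w.arg = y 0 := by
    have := Complex.cos_arg hw0; rw [hw, div_one] at this; exact this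
  have hsn : Real.sin w.arg = y 1 := by
    have := Complex.sin_arg w; rw [hw, div_one] at this; exact this
  have huv : uvec w.arg = y := by
    rw [uvec_eq, hc, hsn]
    ext k; fin_cases k <;> simp [e2basis]
  have hz : z = x₀ + r • y := by
    rw [hy, smul_smul, mul_inv_cancel₀ hr.ne', one_smul]; abel
  rcases le_total 0 w.arg with h0 | h0
  · exact ⟨w.arg, ⟨h0, by linarith [Complex.arg_le_pi w, pi_pos]⟩, by rw [huv, hz]⟩
  · refine ⟨w.arg + 2*π, ⟨by linarith [Complex.neg_pi_lt_arg w, pi_pos], by linarith⟩, ?_⟩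
    rw [uvec_periodic, huv, hz]

lemma fderiv_le_gradSq (u : E2 → E2) (x e : E2) :
    ‖fderiv ℝ u x e‖ ≤ ‖e‖ * √(gradSq u x) := by
  have hy : e = e 0 • e2basis 0 + e 1 • e2basis 1 := by
    ext k; fin_cases k <;> simp [e2basis]
  set A := ‖fderiv ℝ u x (e2basis 0)‖ with hA
  set B := ‖fderiv ℝ u x (e2basis 1)‖ with hB
  have h1 : ‖fderiv ℝ u x e‖ ≤ |e 0| * A + |e 1| * B := by
    conv_lhs => rw [hy, map_add, map_smul, map_smul]
    refine (norm_add_le _ _).trans ?_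
    rw [norm_smul, norm_smul, Real.norm_eq_abs, Real.norm_eq_abs]
  refine h1.trans ?_
  rw [EuclideanSpace.norm_eq, Fin.sum_univ_two, ← Real.sqrt_mul (by positivity)]
  refine Real.le_sqrt_of_sq_le ?_
  unfold gradSq
  rw [Fin.sum_univ_two, ← hA, ← hB]
  simp only [Real.norm_eq_abs]
  nlinarith [sq_nonneg (|e 0| * B - |e 1| * A)]

/-- Oscillation and modulus of a map on a good circle. -/
lemma circle_est {v : E2 → E2} {μ : E2 → ℝ} {ε r σ : ℝ} {x₀ : E2} (hv : Differentiable ℝ v)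
    (hμ : Continuous μ) (hε : 0 < ε) (hεr : ε ≤ r) (hσ : 0 < σ) {L : ℝ}
    (hL : ∀ x, ‖x - x₀‖ = r → ‖fderiv ℝ v x‖ ≤ L)
    (hb : (∫ θ in (0:ℝ)..(2*π), r * ((1/2) * gradSq v (x₀ + r • uvec θ) +
            (‖v (x₀ + r • uvec θ)‖^2 - μ (x₀ + r • uvec θ))^2 / (4*ε^2))) ≤ σ^2 / r) :
    (∫ θ in (0:ℝ)..(2*π), gradSq v (x₀ + r • uvec θ)) ≤ 2 * σ^2 / r^2 ∧
    (∫ θ in (0:ℝ)..(2*π), (‖v (x₀ + r • uvec θ)‖^2 - μ (x₀ + r • uvec θ))^2) ≤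
      4 * ε^2 * σ^2 / r^2 ∧
    ∃ c : E2, (∃ z, ‖z - x₀‖ = r ∧ v z = c ∧ |‖v z‖^2 - μ z| ≤ σ) ∧
      ∀ z, ‖z - x₀‖ = r → ‖v z - c‖ ≤ 5 * σ := by
  have hr : 0 < r := hε.trans_le hεr
  have hγ : ∀ θ, ‖x₀ + r • uvec θ - x₀‖ = r := fun θ => by
    rw [add_sub_cancel_left, norm_smul, uvec_norm, mul_one, Real.norm_of_nonneg hr.le]
  have hγc : Continuous fun θ => x₀ + r • uvec θ := by
    have := uvec_cont; fun_prop
  set G : ℝ → ℝ := fun θ => gradSq v (x₀ + r • uvec θ) with hG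
  set H : ℝ → ℝ := fun θ => (‖v (x₀ + r • uvec θ)‖^2 - μ (x₀ + r • uvec θ))^2 with hH
  have hG0 : ∀ θ, 0 ≤ G θ := fun θ => gradSq_nonneg _ _
  have hH0 : ∀ θ, 0 ≤ H θ := fun θ => sq_nonneg _
  have hL0 : 0 ≤ L := (norm_nonneg _).trans (hL _ (hγ 0))
  have hGm : Measurable G := (gradSq_meas v).comp hγc.measurable
  have hGb : ∀ θ, G θ ≤ 2 * L^2 := fun θ => gradSq_le _ _ (hL _ (hγ θ))
  have hvγ : Continuous fun θ => v (x₀ + r • uvec θ) := hv.continuous.comp hγc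
  have hHc : Continuous H := by
    have := hμ.comp hγc
    exact ((hvγ.norm.pow 2).sub this).pow 2
  have bddint : ∀ (F : ℝ → ℝ) (B a b : ℝ), Measurable F → (∀ θ, |F θ| ≤ B) →
      IntervalIntegrable F volume a b := fun F B a b hm hB =>
    (intervalIntegrable_const (c := B)).mono_fun hm.aestronglyMeasurable
      (Eventually.of_forall fun θ => (hB θ).trans (le_abs_self B))
  have hGi : ∀ a b, IntervalIntegrable G volume a b := fun a b =>
    bddint G (2*L^2) a b hGm fun θ => by rw [abs_of_nonneg (hG0 θ)]; exact hGb θ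
  have hHi : ∀ a b, IntervalIntegrable H volume a b := fun a b => hHc.intervalIntegrable a b
  have hb2 : r * ((1/2) * (∫ θ in (0:ℝ)..(2*π), G θ) + (∫ θ in (0:ℝ)..(2*π), H θ) / (4*ε^2))
      ≤ σ^2 / r := by
    rw [intervalIntegral.integral_const_mul, intervalIntegral.integral_add
      ((hGi _ _).const_mul _) ((hHi _ _).div_const _), intervalIntegral.integral_const_mul,
      intervalIntegral.integral_div] at hb
    exact hb
  have hpi : (0:ℝ) ≤ 2*π := by positivity
  have IG0 : 0 ≤ ∫ θ in (0:ℝ)..(2*π), G θ :=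
    intervalIntegral.integral_nonneg hpi fun θ _ => hG0 θ
  have IH0 : 0 ≤ ∫ θ in (0:ℝ)..(2*π), H θ :=
    intervalIntegral.integral_nonneg hpi fun θ _ => hH0 θ
  set IG := ∫ θ in (0:ℝ)..(2*π), G θ with hIG
  set IH := ∫ θ in (0:ℝ)..(2*π), H θ with hIH
  have hsum : (1/2) * IG + IH / (4*ε^2) ≤ σ^2 / r^2 := by
    rw [le_div_iff₀ hr] at hb2
    rw [le_div_iff₀ (by positivity)]
    calc _ = r * (1 / 2 * IG + IH / (4 * ε ^ 2)) * r := by ring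
      _ ≤ _ := hb2
  have hIGle : IG ≤ 2 * σ^2 / r^2 := by
    have : 0 ≤ IH / (4*ε^2) := by positivity
    rw [mul_div_assoc]; linarith
  have hIHle : IH ≤ 4 * ε^2 * σ^2 / r^2 := by
    have h1 : IH / (4*ε^2) ≤ σ^2 / r^2 := by linarith
    rw [div_le_iff₀ (by positivity)] at h1
    calc IH ≤ σ^2/r^2 * (4*ε^2) := h1
      _ = _ := by ring
  refine ⟨hIGle, hIHle, ?_⟩
  obtain ⟨θs, hθs⟩ : ∃ θ, H θ ≤ σ^2 := by
    by_contra hcon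
    push Not at hcon
    have h1 : ∫ θ in (0:ℝ)..(2*π), σ^2 ≤ IH :=
      intervalIntegral.integral_mono_on hpi intervalIntegrable_const (hHi _ _)
        fun θ _ => (hcon θ).le
    rw [intervalIntegral.integral_const, sub_zero, smul_eq_mul] at h1
    have h2 : 4 * ε^2 * σ^2 / r^2 ≤ 4 * σ^2 := by
      rw [div_le_iff₀ (by positivity)]
      have : ε^2 ≤ r^2 := by gcongr
      nlinarith [sq_nonneg σ]
    have h3 : 0 < σ^2 := by positivity
    nlinarith [pi_gt_three]
  obtain ⟨θs', hθm, hθe⟩ := exists_uvec hr (hγ θs)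
  set D : ℝ → E2 := fun θ => fderiv ℝ v (x₀ + r • uvec θ)
    (r • (-Real.sin θ • e2basis 0 + Real.cos θ • e2basis 1)) with hD
  have hder : ∀ θ, HasDerivAt (fun θ => v (x₀ + r • uvec θ)) (D θ) θ := fun θ => by
    have h1 : HasDerivAt (fun θ => x₀ + r • uvec θ)
      (r • (-Real.sin θ • e2basis 0 + Real.cos θ • e2basis 1)) θ :=
      ((uvec_hasDerivAt θ).const_smul r).const_add x₀
    exact (hv _).hasFDerivAt.comp_hasDerivAt θ h1
  have hτ : ∀ θ : ℝ, ‖(-Real.sin θ • e2basis 0 + Real.cos θ • e2basis 1 : E2)‖ = 1 := fun θ => by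
    rw [EuclideanSpace.norm_eq, Fin.sum_univ_two]
    simp [e2basis]
  have hDle : ∀ θ, ‖D θ‖ ≤ r * √(G θ) := fun θ => by
    refine (fderiv_le_gradSq v _ _).trans ?_
    rw [norm_smul, hτ, mul_one, Real.norm_of_nonneg hr.le]
  have hDle2 : ∀ θ, ‖D θ‖ ≤ σ / 2 + r^2 / (2*σ) * G θ := fun θ => by
    refine (hDle θ).trans ?_
    have h1 := Real.sq_sqrt (hG0 θ)
    have h2 : σ / 2 + r^2 / (2*σ) * G θ - r * √(G θ) = (σ - r * √(G θ))^2 / (2*σ) := by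
      field_simp
      rw [sub_sq, mul_pow, h1]; ring
    have h3 : 0 ≤ (σ - r * √(G θ))^2 / (2*σ) := by positivity
    linarith
  have hDm : Measurable D := by
    have : D = deriv (fun θ => v (x₀ + r • uvec θ)) := funext fun θ => (hder θ).deriv.symm
    rw [this]; exact measurable_deriv _
  have hNi : ∀ a b, IntervalIntegrable (fun θ => σ / 2 + r^2 / (2*σ) * G θ) volume a b :=
    fun a b => intervalIntegrable_const.add ((hGi a b).const_mul _)
  have hDi : ∀ a b, IntervalIntegrable D volume a b := fun a b =>
    (hNi a b).mono_fun hDm.aestronglyMeasurable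
      (Eventually.of_forall fun θ => (hDle2 θ).trans (le_abs_self _))
  have osc : ∀ s t : ℝ, s ∈ Icc 0 (2*π) → t ∈ Icc 0 (2*π) → s ≤ t →
      ‖v (x₀ + r • uvec t) - v (x₀ + r • uvec s)‖ ≤ 5 * σ := by
    intro s t hs ht hst
    rw [← intervalIntegral.integral_eq_sub_of_hasDerivAt (fun θ _ => hder θ) (hDi s t)]
    have h1 : ‖∫ θ in s..t, D θ‖ ≤ ∫ θ in s..t, (σ / 2 + r^2 / (2*σ) * G θ) :=
      intervalIntegral.norm_integral_le_of_norm_le hst (Eventually.of_forall fun θ _ => hDle2 θ)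
        (hNi s t)
    have h2 : ∫ θ in s..t, (σ / 2 + r^2 / (2*σ) * G θ) ≤
        ∫ θ in (0:ℝ)..(2*π), (σ / 2 + r^2 / (2*σ) * G θ) :=
      intervalIntegral.integral_mono_interval hs.1 hst ht.2
        (Eventually.of_forall fun θ => by
          have := hG0 θ
          show 0 ≤ σ / 2 + r^2 / (2*σ) * G θ
          positivity) (hNi _ _)
    replace h2 := h1.trans h2
    rw [intervalIntegral.integral_add intervalIntegrable_const ((hGi _ _).const_mul _),
      intervalIntegral.integral_const, intervalIntegral.integral_const_mul, ← hIG, sub_zero,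
      smul_eq_mul] at h2
    have h3 : r^2 / (2*σ) * IG ≤ σ := by
      calc r^2 / (2*σ) * IG ≤ r^2 / (2*σ) * (2 * σ^2 / r^2) := by gcongr
        _ = σ := by field_simp
    nlinarith [pi_lt_four]
  refine ⟨v (x₀ + r • uvec θs'), ⟨_, hγ θs', rfl, ?_⟩, ?_⟩
  · rw [← hθe]
    exact abs_le_of_sq_le_sq hθs hσ.le
  · intro z hz
    obtain ⟨θ, hθ, rfl⟩ := exists_uvec hr hz
    rcases le_total θ θs' with h | h
    · rw [norm_sub_rev]; exact osc _ _ hθ hθm h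
    · exact osc _ _ hθm hθ h


/-- Radial projection onto the circle of centre `x₀` and radius `r`. -/
def zp (x₀ : E2) (r : ℝ) (x : E2) : E2 := x₀ + (r/‖x - x₀‖) • (x - x₀)

/-- One-homogeneous extension of boundary values. -/
def hext {F : Type*} [NormedAddCommGroup F] [NormedSpace ℝ F] (x₀ : E2) (r : ℝ) (g : E2 → F)
    (x : E2) : F := (‖x - x₀‖ / r) • g (zp x₀ r x)

section
variable {F : Type*} [NormedAddCommGroup F] [NormedSpace ℝ F] {x₀ x : E2} {r : ℝ} {g : E2 → F}

lemma zp_norm (hr : 0 < r) (hx : x ≠ x₀) : ‖zp x₀ r x - x₀‖ = r := by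
  have h : ‖x - x₀‖ ≠ 0 := norm_ne_zero_iff.2 (sub_ne_zero.2 hx)
  unfold zp
  rw [add_sub_cancel_left, norm_smul, norm_div, norm_norm, Real.norm_of_nonneg hr.le,
    div_mul_cancel₀ _ h]

lemma zp_sphere (hr : 0 < r) (hx : ‖x - x₀‖ = r) : zp x₀ r x = x := by
  unfold zp
  rw [hx, div_self hr.ne', one_smul]; abel

lemma hext_sphere (hr : 0 < r) (hx : ‖x - x₀‖ = r) : hext x₀ r g x = g x := by
  unfold hext
  rw [zp_sphere hr hx, hx, div_self hr.ne', one_smul]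

lemma hext_center : hext x₀ r g x₀ = 0 := by simp [hext]

lemma hext_norm_le (hr : 0 < r) {M : ℝ} (hM : ∀ z, ‖z - x₀‖ = r → ‖g z‖ ≤ M) (x : E2) :
    ‖hext x₀ r g x‖ ≤ ‖x - x₀‖ / r * M := by
  by_cases hx : x = x₀
  · rw [hx, hext_center]; simp
  · unfold hext
    rw [norm_smul, norm_div, norm_norm, Real.norm_of_nonneg hr.le]
    have := hM _ (zp_norm hr hx)
    gcongr

lemma hext_lip (hr : 0 < r) {M K : ℝ} (hM : ∀ z, ‖z - x₀‖ = r → ‖g z‖ ≤ M) (hK0 : 0 ≤ K)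
    (hK : ∀ z z', ‖z - x₀‖ = r → ‖z' - x₀‖ = r → ‖g z - g z'‖ ≤ K * ‖z - z'‖) (x x' : E2) :
    ‖hext x₀ r g x - hext x₀ r g x'‖ ≤ (M / r + 2 * K) * ‖x - x'‖ := by
  by_cases hx : x = x₀
  · rw [hx, hext_center, zero_sub, norm_neg]
    refine (hext_norm_le hr hM x').trans ?_
    rw [norm_sub_rev x' x₀]
    have : 0 ≤ 2 * K * ‖x₀ - x'‖ := by positivity
    calc _ = M / r * ‖x₀ - x'‖ := by ring
      _ ≤ _ := by linarith
  by_cases hx' : x' = x₀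
  · rw [hx', hext_center, sub_zero]
    refine (hext_norm_le hr hM x).trans ?_
    have : 0 ≤ 2 * K * ‖x - x₀‖ := by positivity
    calc _ = M / r * ‖x - x₀‖ := by ring
      _ ≤ _ := by linarith
  have hz := zp_norm hr hx
  have hz' := zp_norm hr hx'
  set z := zp x₀ r x with hzd
  set z' := zp x₀ r x' with hzd'
  set n := ‖x - x₀‖ with hn
  set n' := ‖x' - x₀‖ with hn'
  have hn0 : n ≠ 0 := norm_ne_zero_iff.2 (sub_ne_zero.2 hx)
  have hn0' : n' ≠ 0 := norm_ne_zero_iff.2 (sub_ne_zero.2 hx')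
  have hnn : |n - n'| ≤ ‖x - x'‖ := by
    have := abs_norm_sub_norm_le (x - x₀) (x' - x₀)
    rwa [sub_sub_sub_cancel_right] at this
  have e1 : hext x₀ r g x - hext x₀ r g x' = ((n - n')/r) • g z + (n'/r) • (g z - g z') := by
    unfold hext
    rw [← hzd, ← hzd', ← hn, ← hn', smul_sub, sub_div, sub_smul]; abel
  have e2 : (n'/r) • (z - z') = ((n' - n)/n) • (x - x₀) + (x - x') := by
    rw [hzd, hzd']
    unfold zp
    rw [← hn, ← hn', add_sub_add_left_eq_sub, smul_sub, smul_smul, smul_smul]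
    rw [show n'/r * (r/n) = n'/n by field_simp, show n'/r * (r/n') = 1 by field_simp,
      show (n'-n)/n = n'/n - 1 by field_simp, sub_smul, one_smul, one_smul]
    abel
  have h2 : n'/r * ‖z - z'‖ ≤ 2 * ‖x - x'‖ := by
    have : ‖(n'/r) • (z - z')‖ ≤ 2 * ‖x - x'‖ := by
      rw [e2]
      refine (norm_add_le _ _).trans ?_
      rw [norm_smul, norm_div, ← hn, Real.norm_eq_abs, abs_sub_comm, Real.norm_of_nonneg
        (norm_nonneg _ : 0 ≤ n), div_mul_cancel₀ _ hn0]
      linarith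
    rwa [norm_smul, norm_div, Real.norm_of_nonneg (norm_nonneg _ : 0 ≤ n'),
      Real.norm_of_nonneg hr.le] at this
  rw [e1]
  refine (norm_add_le _ _).trans ?_
  rw [norm_smul, norm_smul, norm_div, norm_div, Real.norm_of_nonneg (norm_nonneg _ : 0 ≤ n'),
      Real.norm_of_nonneg hr.le, Real.norm_eq_abs]
  have hMz := hM z hz
  have hM0 : 0 ≤ M := (norm_nonneg _).trans hMz
  have t1 : |n - n'|/r * ‖g z‖ ≤ ‖x - x'‖ / r * M := by gcongr
  have t2 : n'/r * ‖g z - g z'‖ ≤ K * (2 * ‖x - x'‖) := by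
    calc n'/r * ‖g z - g z'‖ ≤ n'/r * (K * ‖z - z'‖) := by gcongr; exact hK z z' hz hz'
      _ = K * (n'/r * ‖z - z'‖) := by ring
      _ ≤ _ := by gcongr
  calc _ ≤ ‖x - x'‖ / r * M + K * (2 * ‖x - x'‖) := add_le_add t1 t2
    _ = _ := by ring

lemma norm_hasFDerivAt {p : E2} (hp : p ≠ 0) :
    HasFDerivAt (fun p : E2 => ‖p‖) (‖p‖⁻¹ • innerSL ℝ p) p := by
  have h1 : HasFDerivAt (fun p : E2 => ‖p‖^2) (2 • (innerSL ℝ p)) p :=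
    (hasStrictFDerivAt_norm_sq p).hasFDerivAt
  have hn : ‖p‖ ≠ 0 := norm_ne_zero_iff.2 hp
  have h2 := h1.sqrt (by positivity)
  have e : (fun p : E2 => √(‖p‖^2)) = fun p => ‖p‖ := by
    funext q; exact Real.sqrt_sq (norm_nonneg q)
  rw [e] at h2
  refine HasFDerivAt.congr_fderiv h2 ?_
  rw [Real.sqrt_sq (norm_nonneg p)]
  ext q
  simp
  field_simp

lemma hext_deriv (hr : 0 < r) (hx : x ≠ x₀) {g' : E2 →L[ℝ] F}
    (hg : HasFDerivAt g g' (zp x₀ r x)) :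
    ∃ L : E2 →L[ℝ] F, HasFDerivAt (hext x₀ r g) L x ∧
      ∀ e, ∃ τ : E2, ‖τ‖ ≤ ‖e‖ ∧ ‖L e‖ ≤ ‖g' τ‖ + ‖e‖ / r * ‖g (zp x₀ r x)‖ := by
  have hy : x - x₀ ≠ 0 := sub_ne_zero.2 hx
  have hn : ‖x - x₀‖ ≠ 0 := norm_ne_zero_iff.2 hy
  have hn0 : 0 < ‖x - x₀‖ := norm_pos_iff.2 hy
  set y := x - x₀ with hyd
  set A : E2 →L[ℝ] ℝ := ‖y‖⁻¹ • innerSL ℝ y with hA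
  have d1 : HasFDerivAt (fun x : E2 => x - x₀) (ContinuousLinearMap.id ℝ E2) x :=
    (hasFDerivAt_id x).sub_const x₀
  have d2 : HasFDerivAt (fun x : E2 => ‖x - x₀‖) A x := by
    have h := HasFDerivAt.comp x (g := fun p : E2 => ‖p‖) (norm_hasFDerivAt hy) d1
    exact h
  have d3 : HasFDerivAt (fun x : E2 => r / ‖x - x₀‖) (-(r / ‖y‖^2) • A) x := by
    have h := ((hasDerivAt_inv hn).comp_hasFDerivAt x d2).const_mul r
    have e : (fun x : E2 => r / ‖x - x₀‖) = fun x => r * ((fun y => y⁻¹) ∘ fun x => ‖x - x₀‖) x := by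
      funext x; simp [div_eq_mul_inv]
    rw [e]
    refine HasFDerivAt.congr_fderiv h ?_
    ext q; simp; ring
  have d4 : HasFDerivAt (zp x₀ r) ((r/‖y‖) • ContinuousLinearMap.id ℝ E2 +
      (-(r / ‖y‖^2) • A).smulRight y) x := (d3.smul d1).const_add x₀
  have d5 : HasFDerivAt (fun x : E2 => ‖x - x₀‖ / r) (r⁻¹ • A) x := by
    have := d2.mul_const r⁻¹
    exact this
  have d6 := d5.smul (hg.comp x d4)
  refine ⟨_, d6, fun e => ?_⟩
  have hAe : |A e| ≤ ‖e‖ := by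
    have := abs_real_inner_le_norm y e
    simp only [hA, smul_apply, innerSL_apply_apply, smul_eq_mul, abs_mul, abs_inv, abs_norm]
    rw [inv_mul_le_iff₀ hn0]; exact this
  refine ⟨e - (A e / ‖y‖) • y, ?_, ?_⟩
  · rw [← sq_le_sq₀ (norm_nonneg _) (norm_nonneg _), norm_sub_sq_real, norm_smul,
      inner_smul_right, norm_div, norm_norm, div_mul_cancel₀ _ hn, Real.norm_eq_abs, sq_abs]
    have : inner ℝ e y = ‖y‖ * A e := by
      simp only [hA, smul_apply, innerSL_apply_apply, smul_eq_mul]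
      rw [real_inner_comm]; field_simp
    rw [this]
    have : 2 * (A e / ‖y‖ * (‖y‖ * A e)) = 2 * (A e)^2 := by field_simp
    rw [this]
    nlinarith [sq_nonneg (A e)]
  · have e1 : ((‖y‖ / r) • g'.comp ((r/‖y‖) • ContinuousLinearMap.id ℝ E2 +
      (-(r / ‖y‖^2) • A).smulRight y) + (r⁻¹ • A).smulRight (g (zp x₀ r x))) e =
      g' (e - (A e / ‖y‖) • y) + (r⁻¹ * A e) • g (zp x₀ r x) := by
      simp only [add_apply, smul_apply, ContinuousLinearMap.comp_apply,
        ContinuousLinearMap.smulRight_apply, ContinuousLinearMap.id_apply, smul_eq_mul]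
      rw [← map_smul g']
      congr 2
      rw [smul_add, smul_smul, smul_smul, show ‖y‖/r * (r/‖y‖) = 1 by field_simp, one_smul,
        show ‖y‖ / r * (-(r/‖y‖^2) * A e) = -(A e/‖y‖) by field_simp, neg_smul, sub_eq_add_neg]
    refine (le_of_eq (congrArg norm e1)).trans ((norm_add_le _ _).trans ?_)
    gcongr
    rw [norm_smul, norm_mul, norm_inv, Real.norm_of_nonneg hr.le, Real.norm_eq_abs, div_eq_inv_mul]
    gcongr

end

/-- Normalisation of a vector. -/
def nrm (p : E2) : E2 := ‖p‖⁻¹ • p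

lemma nrm_norm {p : E2} (hp : p ≠ 0) : ‖nrm p‖ = 1 := norm_smul_inv_norm hp

lemma nrm_lip {κ : ℝ} (hκ : 0 < κ) {p q : E2} (hp : κ ≤ ‖p‖) (hq : κ ≤ ‖q‖) :
    ‖nrm p - nrm q‖ ≤ 2 / κ * ‖p - q‖ := by
  have hp0 : 0 < ‖p‖ := hκ.trans_le hp
  have hq0 : 0 < ‖q‖ := hκ.trans_le hq
  have e : nrm p - nrm q = ‖p‖⁻¹ • (p - q) + ((‖q‖ - ‖p‖) / (‖p‖ * ‖q‖)) • q := by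
    unfold nrm
    rw [show (‖q‖ - ‖p‖) / (‖p‖ * ‖q‖) = ‖p‖⁻¹ - ‖q‖⁻¹ by field_simp, sub_smul, smul_sub]; abel
  rw [e]
  refine (norm_add_le _ _).trans ?_
  rw [norm_smul, norm_smul, norm_inv, norm_norm, norm_div, norm_mul, norm_norm, norm_norm,
    Real.norm_eq_abs, div_mul_eq_mul_div, mul_div_mul_right _ _ hq0.ne']
  have h1 : |‖q‖ - ‖p‖| ≤ ‖p - q‖ := by rw [abs_sub_comm]; exact abs_norm_sub_norm_le p q
  have h2 : |‖q‖ - ‖p‖| / ‖p‖ ≤ ‖p - q‖ / κ := by gcongr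
  have h3 : ‖p‖⁻¹ * ‖p - q‖ ≤ κ⁻¹ * ‖p - q‖ := by gcongr
  calc _ ≤ κ⁻¹ * ‖p - q‖ + ‖p - q‖ / κ := add_le_add h3 h2
    _ = _ := by ring

lemma nrm_deriv {κ : ℝ} (hκ : 0 < κ) {p : E2} (hp : κ ≤ ‖p‖) :
    ∃ L : E2 →L[ℝ] E2, HasFDerivAt nrm L p ∧ ∀ q, ‖L q‖ ≤ 2 / κ * ‖q‖ := by
  have hp0 : 0 < ‖p‖ := hκ.trans_le hp
  have hne : p ≠ 0 := norm_pos_iff.1 hp0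
  have d := ((hasDerivAt_inv hp0.ne').comp_hasFDerivAt p (norm_hasFDerivAt hne)).smul
    (hasFDerivAt_id p)
  refine ⟨_, d, fun q => ?_⟩
  have hin := abs_real_inner_le_norm p q
  simp only [add_apply, smul_apply, ContinuousLinearMap.smulRight_apply,
    ContinuousLinearMap.id_apply, smul_eq_mul, innerSL_apply_apply, Function.comp_apply, id]
  refine (norm_add_le _ _).trans ?_
  rw [norm_smul, norm_smul, norm_inv, norm_norm]
  have h3 : ‖p‖⁻¹ * ‖q‖ ≤ κ⁻¹ * ‖q‖ := by gcongr
  have h2 : ‖-(‖p‖^2)⁻¹ * (‖p‖⁻¹ * inner ℝ p q)‖ * ‖p‖ ≤ κ⁻¹ * ‖q‖ := by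
    refine le_trans ?_ h3
    rw [norm_mul, norm_neg, norm_mul, norm_inv, norm_inv, norm_pow, norm_norm, Real.norm_eq_abs]
    calc (‖p‖^2)⁻¹ * (‖p‖⁻¹ * |inner ℝ p q|) * ‖p‖ = (‖p‖^2)⁻¹ * |inner ℝ p q| := by field_simp
      _ ≤ (‖p‖^2)⁻¹ * (‖p‖ * ‖q‖) := by gcongr
      _ = _ := by field_simp
  calc _ ≤ κ⁻¹ * ‖q‖ + κ⁻¹ * ‖q‖ := add_le_add h3 h2
    _ = _ := by ring


lemma competitor {v : E2 → E2} {β : E2 → ℝ} {x₀ c : E2} {r κ M Lb Kv : ℝ} (hr : 0 < r)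
    (hκ : 0 < κ) (hκM : κ ≤ M) (hLb : 0 ≤ Lb) (hKv : 0 ≤ Kv) (hv : Differentiable ℝ v)
    (hvK : ∀ z z', ‖z - x₀‖ = r → ‖z' - x₀‖ = r → ‖v z - v z'‖ ≤ Kv * ‖z - z'‖)
    (hκv : ∀ z, ‖z - x₀‖ = r → κ ≤ ‖v z‖) (hMv : ∀ z, ‖z - x₀‖ = r → ‖v z‖ ≤ M)
    (hc : 2 * κ ≤ ‖c‖) (hvc : ∀ z, ‖z - x₀‖ = r → ‖v z - c‖ ≤ κ)
    (hβd : ∀ x ∈ Metric.closedBall x₀ r, DifferentiableAt ℝ β x)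
    (hβL : ∀ x ∈ Metric.closedBall x₀ r, ‖fderiv ℝ β x‖ ≤ Lb)
    (hβ0 : ∀ x ∈ Metric.closedBall x₀ r, 0 ≤ β x)
    (hβM : ∀ x ∈ Metric.closedBall x₀ r, β x ≤ M) :
    ∃ w : E2 → E2, (∃ K : ℝ, 0 ≤ K ∧ ∀ x ∈ Metric.closedBall x₀ r, ∀ x' ∈ Metric.closedBall x₀ r,
        ‖w x - w x'‖ ≤ K * ‖x - x'‖) ∧ (∀ z, ‖z - x₀‖ = r → w z = v z) ∧
      ∀ x ∈ Metric.ball x₀ r, x ≠ x₀ → DifferentiableAt ℝ w x ∧ ‖w x‖ ≤ 2 * M ∧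
        (‖w x‖^2 - β x^2)^2 ≤ 9 * M^2 * (‖v (zp x₀ r x)‖ - β (zp x₀ r x))^2 ∧
        ∀ e, ‖e‖ = 1 → ‖fderiv ℝ w x e‖ ≤ (2 * Lb + 1 + M + 4 * M / κ * (1 + M)) *
          (1 + 1/r + √(gradSq v (zp x₀ r x))) := by
  have hM : 0 < M := hκ.trans_le hκM
  have hcb : ∀ z, ‖z - x₀‖ = r → z ∈ Metric.closedBall x₀ r := fun z hz => by
    rw [mem_closedBall_iff_norm, hz]
  have hβK : ∀ x ∈ Metric.closedBall x₀ r, ∀ x' ∈ Metric.closedBall x₀ r,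
      ‖β x - β x'‖ ≤ Lb * ‖x - x'‖ := fun x hx x' hx' =>
    (convex_closedBall x₀ r).norm_image_sub_le_of_norm_fderiv_le hβd hβL hx' hx
  set g : E2 → ℝ := fun z => ‖v z‖ - β z with hg
  have hgM : ∀ z, ‖z - x₀‖ = r → ‖g z‖ ≤ M := fun z hz => by
    rw [Real.norm_eq_abs, abs_le]
    have h1 := hMv z hz
    have h2 := hβ0 z (hcb z hz)
    have h3 := hβM z (hcb z hz)
    have h4 := norm_nonneg (v z)
    constructor <;> simp only [hg] <;> linarith
  have hgK : ∀ z z', ‖z - x₀‖ = r → ‖z' - x₀‖ = r → ‖g z - g z'‖ ≤ (Kv + Lb) * ‖z - z'‖ := by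
    intro z z' hz hz'
    have h1 := hvK z z' hz hz'
    have h2 := hβK z (hcb z hz) z' (hcb z' hz')
    have h3 := abs_norm_sub_norm_le (v z) (v z')
    have e : g z - g z' = (‖v z‖ - ‖v z'‖) - (β z - β z') := by simp only [hg]; ring
    rw [e]
    refine (norm_sub_le _ _).trans ?_
    rw [Real.norm_eq_abs (‖v z‖ - ‖v z'‖)]
    linarith
  set V : E2 → E2 := fun x => c + hext x₀ r (fun z => v z - c) x with hV
  set T : E2 → ℝ := fun x => β x + hext x₀ r g x with hT
  set w : E2 → E2 := fun x => T x • nrm (V x) with hw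
  have hs1 : ∀ x ∈ Metric.closedBall x₀ r, ‖x - x₀‖ / r ≤ 1 := fun x hx => by
    rw [div_le_one hr]; rwa [mem_closedBall_iff_norm] at hx
  have hVlow : ∀ x ∈ Metric.closedBall x₀ r, κ ≤ ‖V x‖ := fun x hx => by
    have h1 := hext_norm_le hr (g := fun z => v z - c) hvc x
    have h2 : ‖x - x₀‖ / r * κ ≤ 1 * κ := by gcongr; exact hs1 x hx
    have h3 : ‖c‖ ≤ ‖V x‖ + ‖hext x₀ r (fun z => v z - c) x‖ := by
      have := norm_sub_le (V x) (hext x₀ r (fun z => v z - c) x)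
      simpa [hV] using this
    linarith
  have hTM : ∀ x ∈ Metric.closedBall x₀ r, |T x| ≤ 2 * M := fun x hx => by
    have h1 := hext_norm_le hr hgM x
    have h2 : ‖x - x₀‖ / r * M ≤ 1 * M := by gcongr; exact hs1 x hx
    have h3 := hβ0 x hx
    have h4 := hβM x hx
    rw [Real.norm_eq_abs] at h1
    refine (abs_add_le _ _).trans ?_
    rw [abs_of_nonneg h3]; linarith
  have hwn : ∀ x ∈ Metric.closedBall x₀ r, ‖w x‖ = |T x| := fun x hx => by
    have : V x ≠ 0 := norm_pos_iff.1 (hκ.trans_le (hVlow x hx))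
    simp only [hw]
    rw [norm_smul, nrm_norm this, mul_one, Real.norm_eq_abs]
  refine ⟨w, ⟨(Lb + (M/r + 2*(Kv+Lb))) + 2*M*(2/κ*(κ/r + 2*Kv)), by positivity, ?_⟩, ?_, ?_⟩
  · intro x hx x' hx'
    have e : w x - w x' = (T x - T x') • nrm (V x) + T x' • (nrm (V x) - nrm (V x')) := by
      simp only [hw]; rw [sub_smul, smul_sub]; abel
    have hV0 : V x ≠ 0 := norm_pos_iff.1 (hκ.trans_le (hVlow x hx))
    rw [e]
    refine (norm_add_le _ _).trans ?_
    rw [norm_smul, norm_smul, nrm_norm hV0, mul_one, Real.norm_eq_abs (T x')]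
    have h1 : ‖T x - T x'‖ ≤ (Lb + (M/r + 2*(Kv+Lb))) * ‖x - x'‖ := by
      have e2 : T x - T x' = (β x - β x') + (hext x₀ r g x - hext x₀ r g x') := by
        simp only [hT]; ring
      rw [e2]
      refine (norm_add_le _ _).trans ?_
      have a1 := hβK x hx x' hx'
      have a2 := hext_lip hr hgM (by positivity) hgK x x'
      linarith
    have h2 : ‖nrm (V x) - nrm (V x')‖ ≤ 2/κ * ((κ/r + 2*Kv) * ‖x - x'‖) := by
      refine (nrm_lip hκ (hVlow x hx) (hVlow x' hx')).trans ?_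
      gcongr
      have := hext_lip hr (g := fun z => v z - c) hvc hKv
        (fun z z' hz hz' => by rw [sub_sub_sub_cancel_right]; exact hvK z z' hz hz') x x'
      simpa [hV] using this
    have h3 : |T x'| * ‖nrm (V x) - nrm (V x')‖ ≤ 2*M * (2/κ * ((κ/r + 2*Kv) * ‖x - x'‖)) :=
      mul_le_mul (hTM x' hx') h2 (norm_nonneg _) (by positivity)
    calc _ ≤ _ := add_le_add h1 h3
      _ = _ := by ring
  · intro z hz
    have hv0 : ‖v z‖ ≠ 0 := (hκ.trans_le (hκv z hz)).ne'
    simp only [hw, hT, hV]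
    rw [hext_sphere hr hz, hext_sphere hr hz]
    simp only [hg, nrm, add_sub_cancel]
    rw [smul_smul, mul_inv_cancel₀ hv0, one_smul]
  · intro x hxb hx
    have hxc := Metric.ball_subset_closedBall hxb
    have hz := zp_norm hr hx
    have hzc := hcb _ hz
    set z := zp x₀ r x with hzd
    have hvz : HasFDerivAt v (fderiv ℝ v z) z := (hv z).hasFDerivAt
    have hvz0 : v z ≠ 0 := norm_pos_iff.1 (hκ.trans_le (hκv z hz))
    have hdg : HasFDerivAt g ((‖v z‖⁻¹ • innerSL ℝ (v z)).comp (fderiv ℝ v z) - fderiv ℝ β z) z := by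
      have h := HasFDerivAt.comp z (g := fun p : E2 => ‖p‖) (norm_hasFDerivAt hvz0) hvz
      exact h.sub (hβd z hzc).hasFDerivAt
    obtain ⟨LT, hLT, hLTe⟩ := hext_deriv hr hx (g := g) hdg
    obtain ⟨LV, hLV, hLVe⟩ := hext_deriv hr hx (g := fun z => v z - c) (hvz.sub_const c)
    obtain ⟨LN, hLN, hLNe⟩ := nrm_deriv hκ (hVlow x hxc)
    have dV : HasFDerivAt V LV x := hLV.const_add c
    have dT : HasFDerivAt T (fderiv ℝ β x + LT) x := (hβd x hxc).hasFDerivAt.add hLT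
    have dw : HasFDerivAt w (T x • LN.comp LV + (fderiv ℝ β x + LT).smulRight (nrm (V x))) x :=
      dT.smul (hLN.comp x dV)
    refine ⟨dw.differentiableAt, ?_, ?_, ?_⟩
    · rw [hwn x hxc]; exact hTM x hxc
    · rw [hwn x hxc, sq_abs]
      have h1 : |T x - β x| ≤ |g z| := by
        have : T x - β x = (‖x - x₀‖ / r) * g z := by simp [hT, hext, ← hzd]
        rw [this, abs_mul, abs_of_nonneg (by positivity)]
        have := hs1 x hxc
        nlinarith [abs_nonneg (g z)]
      have h2 : |T x + β x| ≤ 3 * M := by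
        refine (abs_add_le _ _).trans ?_
        rw [abs_of_nonneg (hβ0 x hxc)]
        linarith [hTM x hxc, hβM x hxc]
      have h3 : (T x - β x)^2 ≤ (g z)^2 := sq_le_sq.2 h1
      have h4 : (T x + β x)^2 ≤ (3*M)^2 := sq_le_sq' (by linarith [(abs_le.1 h2).1]) (abs_le.1 h2).2
      calc (T x^2 - β x^2)^2 = (T x + β x)^2 * (T x - β x)^2 := by ring
        _ ≤ (3*M)^2 * (g z)^2 := by gcongr
        _ = _ := by ring
    · intro e he
      rw [dw.fderiv]
      have hV0 : V x ≠ 0 := norm_pos_iff.1 (hκ.trans_le (hVlow x hxc))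
      simp only [add_apply, smul_apply, ContinuousLinearMap.comp_apply,
        ContinuousLinearMap.smulRight_apply]
      refine (norm_add_le _ _).trans ?_
      rw [norm_smul, norm_smul, nrm_norm hV0, mul_one, Real.norm_eq_abs (T x)]
      set q := √(gradSq v z) with hq
      have hq0 : 0 ≤ q := Real.sqrt_nonneg _
      have hDv : ∀ τ : E2, ‖τ‖ ≤ 1 → ‖fderiv ℝ v z τ‖ ≤ q := fun τ hτ =>
        (fderiv_le_gradSq v z τ).trans (by nlinarith)
      have b1 : ‖LV e‖ ≤ q + M / r := by
        obtain ⟨τ, h1, h2⟩ := hLVe e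
        rw [he] at h1 h2
        have h3 := hDv τ h1
        have h4 : 1 / r * ‖v z - c‖ ≤ 1 / r * M := by
          gcongr; exact (hvc z hz).trans hκM
        calc _ ≤ _ := h2
          _ ≤ q + 1 / r * M := add_le_add h3 h4
          _ = _ := by ring
      have b2 : ‖LT e‖ ≤ q + Lb + M / r := by
        obtain ⟨τ, h1, h2⟩ := hLTe e
        rw [he] at h1 h2
        have h3 := hDv τ h1
        have h4 : 1 / r * ‖g z‖ ≤ 1 / r * M := by
          gcongr; exact hgM z hz
        have h5 : ‖((‖v z‖⁻¹ • innerSL ℝ (v z)).comp (fderiv ℝ v z) - fderiv ℝ β z) τ‖ ≤ q + Lb := by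
          rw [sub_apply]
          refine (norm_sub_le _ _).trans (add_le_add ?_ ?_)
          · refine le_trans ?_ h3
            simp only [ContinuousLinearMap.comp_apply, smul_apply, innerSL_apply_apply, smul_eq_mul]
            rw [norm_mul, norm_inv, norm_norm, inv_mul_le_iff₀ (norm_pos_iff.2 hvz0)]
            exact abs_real_inner_le_norm _ _
          · refine ((fderiv ℝ β z).le_opNorm τ).trans ?_
            have := hβL z hzc
            nlinarith [norm_nonneg τ]
        calc _ ≤ _ := h2
          _ ≤ q + Lb + 1 / r * M := add_le_add h5 h4
          _ = _ := by ring
      have b3 : ‖(fderiv ℝ β x) e + LT e‖ ≤ 2 * Lb + q + M / r := by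
        refine (norm_add_le _ _).trans ?_
        have := (fderiv ℝ β x).le_opNorm e
        rw [he, mul_one] at this
        linarith [hβL x hxc]
      have b4 : |T x| * ‖LN (LV e)‖ ≤ 2*M * (2/κ * (q + M/r)) := by
        refine mul_le_mul (hTM x hxc) ((hLNe _).trans ?_) (norm_nonneg _) (by positivity)
        gcongr
      have hr' : 0 < 1/r := by positivity
      have b5 : 2 * Lb + q + M / r ≤ (2*Lb + 1 + M) * (1 + 1/r + q) := by
        have : (2*Lb + 1 + M) * (1 + 1/r + q) - (2 * Lb + q + M / r) =
          2*Lb*(1/r+q) + (1 + 1/r) + M*(1+q) := by ring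
        have : 0 ≤ 2*Lb*(1/r+q) + (1 + 1/r) + M*(1+q) := by positivity
        linarith
      have b6 : 2*M * (2/κ * (q + M/r)) ≤ 4 * M / κ * (1 + M) * (1 + 1/r + q) := by
        have h1 : q + M/r ≤ (1+M) * (1 + 1/r + q) := by
          have : (1+M) * (1 + 1/r + q) - (q + M/r) = 1 + 1/r + M*(1+q) := by ring
          have : 0 ≤ 1 + 1/r + M*(1+q) := by positivity
          linarith
        calc 2*M * (2/κ * (q + M/r)) ≤ 2*M * (2/κ * ((1+M) * (1 + 1/r + q))) := by gcongr
          _ = _ := by ring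
      calc _ ≤ _ := add_le_add (b4.trans b6) (b3.trans b5)
        _ = _ := by ring


lemma glue_lip {w v : E2 → E2} {x₀ : E2} {r K Kv : ℝ} (hr : 0 < r) (hK0 : 0 ≤ K) (hKv0 : 0 ≤ Kv)
    (hK : ∀ x ∈ Metric.closedBall x₀ r, ∀ x' ∈ Metric.closedBall x₀ r, ‖w x - w x'‖ ≤ K * ‖x - x'‖)
    (hKv : ∀ x ∈ Metric.closedBall x₀ r, ∀ x' ∈ Metric.closedBall x₀ r,
      ‖v x - v x'‖ ≤ Kv * ‖x - x'‖)
    (hwv : ∀ z, ‖z - x₀‖ = r → w z = v z) :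
    LipschitzWith (Real.toNNReal (K + Kv))
      ((Metric.closedBall x₀ r).indicator (fun x => w x - v x)) := by
  classical
  set ψ := (Metric.closedBall x₀ r).indicator (fun x => w x - v x) with hψ
  have hin : ∀ x ∈ Metric.closedBall x₀ r, ψ x = w x - v x := fun x hx => indicator_of_mem hx _
  have hout : ∀ x, x ∉ Metric.closedBall x₀ r → ψ x = 0 := fun x hx => indicator_of_notMem hx _
  have hsph : ∀ z, ‖z - x₀‖ = r → z ∈ Metric.closedBall x₀ r := fun z hz => by
    rw [mem_closedBall_iff_norm, hz]
  have h1 : ∀ x ∈ Metric.closedBall x₀ r, ∀ x' ∈ Metric.closedBall x₀ r,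
      ‖ψ x - ψ x'‖ ≤ (K + Kv) * ‖x - x'‖ := fun x hx x' hx' => by
    rw [hin x hx, hin x' hx', show w x - v x - (w x' - v x') = (w x - w x') - (v x - v x') by abel,
      add_mul]
    exact (norm_sub_le _ _).trans (add_le_add (hK x hx x' hx') (hKv x hx x' hx'))
  have h2 : ∀ x ∈ Metric.closedBall x₀ r, ∀ x', x' ∉ Metric.closedBall x₀ r →
      ‖ψ x - ψ x'‖ ≤ (K + Kv) * ‖x - x'‖ := fun x hx x' hx' => by
    have hx1 := mem_closedBall_iff_norm.1 hx
    have hx'1 : r < ‖x' - x₀‖ := by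
      rw [mem_closedBall_iff_norm] at hx'; exact not_le.1 hx'
    have htri : ‖x' - x₀‖ - ‖x - x₀‖ ≤ ‖x - x'‖ := by
      have := norm_sub_norm_le (x' - x₀) (x - x₀)
      rwa [sub_sub_sub_cancel_right, norm_sub_rev x' x] at this
    obtain ⟨p, hp, hpx⟩ : ∃ p, ‖p - x₀‖ = r ∧ ‖x - p‖ ≤ r - ‖x - x₀‖ := by
      by_cases h : x = x₀
      · refine ⟨x₀ + r • e2basis 0, ?_, ?_⟩
        · rw [add_sub_cancel_left, norm_smul, e2basis_norm, mul_one, Real.norm_of_nonneg hr.le]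
        · rw [h, sub_self, norm_zero, sub_zero, norm_sub_rev, add_sub_cancel_left, norm_smul,
            e2basis_norm, mul_one, Real.norm_of_nonneg hr.le]
      · refine ⟨zp x₀ r x, zp_norm hr h, ?_⟩
        have hn : 0 < ‖x - x₀‖ := norm_pos_iff.2 (sub_ne_zero.2 h)
        have e : zp x₀ r x - x = (r/‖x - x₀‖ - 1) • (x - x₀) := by
          unfold zp; module
        rw [norm_sub_rev, e, norm_smul, Real.norm_of_nonneg]
        · rw [sub_mul, div_mul_cancel₀ _ hn.ne', one_mul]
        · rw [sub_nonneg, le_div_iff₀ hn, one_mul]; exact hx1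
    have hψp : ψ p = 0 := by rw [hin p (hsph p hp), hwv p hp, sub_self]
    rw [hout x' hx', ← hψp]
    refine (h1 x hx p (hsph p hp)).trans ?_
    have : 0 ≤ K + Kv := by positivity
    gcongr
    linarith
  refine LipschitzWith.of_dist_le_mul fun x x' => ?_
  rw [dist_eq_norm, dist_eq_norm, Real.coe_toNNReal _ (by positivity)]
  by_cases hx : x ∈ Metric.closedBall x₀ r
  · by_cases hx' : x' ∈ Metric.closedBall x₀ r
    · exact h1 x hx x' hx'
    · exact h2 x hx x' hx'
  · by_cases hx' : x' ∈ Metric.closedBall x₀ r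
    · rw [norm_sub_rev, norm_sub_rev x]; exact h2 x' hx' x hx
    · rw [hout x hx, hout x' hx', sub_self, norm_zero]; positivity

lemma fderiv_le_of_lipOn {u : E2 → E2} {x₀ : E2} {r K : ℝ} (hK0 : 0 ≤ K)
    (hK : ∀ x ∈ Metric.closedBall x₀ r, ∀ x' ∈ Metric.closedBall x₀ r, ‖u x - u x'‖ ≤ K * ‖x - x'‖)
    {x : E2} (hx : x ∈ Metric.ball x₀ r) : ‖fderiv ℝ u x‖ ≤ K := by
  refine norm_fderiv_le_of_lip' ℝ hK0 ?_
  filter_upwards [Metric.isOpen_ball.mem_nhds hx] with y hy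
  exact hK y (Metric.ball_subset_closedBall hy) x (Metric.ball_subset_closedBall hx)

lemma dens_intOn {ε a : ℝ} {μ : E2 → ℝ} {f u w : E2 → E2} {x₀ : E2} {r K : ℝ} (hε : 0 < ε)
    (hμ : Continuous μ) (hf : Continuous f) (hu : Continuous u) (hK0 : 0 ≤ K)
    (hK : ∀ x ∈ Metric.closedBall x₀ r, ∀ x' ∈ Metric.closedBall x₀ r, ‖w x - w x'‖ ≤ K * ‖x - x'‖)
    (huw : ∀ x ∈ Metric.ball x₀ r, u x = w x) :
    IntegrableOn (dens ε a μ f w) (Metric.ball x₀ r) := by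
  have hcpt := isCompact_closedBall x₀ r
  obtain ⟨Bu, hBu⟩ := hcpt.exists_bound_of_continuousOn hu.continuousOn
  obtain ⟨Bm, hBm⟩ := hcpt.exists_bound_of_continuousOn hμ.continuousOn
  obtain ⟨Bf, hBf⟩ := hcpt.exists_bound_of_continuousOn hf.continuousOn
  have hmb : MeasurableSet (Metric.ball x₀ r) := Metric.isOpen_ball.measurableSet
  have hev : ∀ x ∈ Metric.ball x₀ r, u =ᶠ[𝓝 x] w := fun x hx => by
    filter_upwards [Metric.isOpen_ball.mem_nhds hx] with y hy using huw y hy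
  have hd : EqOn (dens ε a μ f u) (dens ε a μ f w) (Metric.ball x₀ r) :=
    fun x hx => dens_congr (hev x hx)
  refine (integrableOn_congr_fun hd hmb).1 ?_
  refine Measure.integrableOn_of_bounded
    (M := K^2 + (1/(2*ε^2)) * Bm * Bu^2 + (1/(4*ε^2)) * Bu^4 + |a/ε| * (Bf * Bu))
    measure_ball_lt_top.ne (dens_meas hμ hf hu).aestronglyMeasurable ?_
  refine (ae_restrict_iff' hmb).2 (Eventually.of_forall fun x hx => ?_)
  have hc := Metric.ball_subset_closedBall hx
  refine dens_bound hε ?_ (hBu x hc) (hBm x hc) (hBf x hc)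
  rw [(hev x hx).fderiv_eq]
  exact fderiv_le_of_lipOn hK0 hK hx

lemma ball_compare {ε a : ℝ} {μ : E2 → ℝ} {f v w : E2 → E2} {x₀ : E2} {r K Kv ρ0 : ℝ} (hε : 0 < ε)
    (hμ : Continuous μ) (hf : Continuous f) (hm : IsMinimizer ε a μ f v)
    (hi : Integrable (dens ε a μ f v)) (hr : 0 < r) (hK0 : 0 ≤ K) (hKv0 : 0 ≤ Kv)
    (hsub : Metric.closedBall x₀ r ⊆ Metric.ball (0:E2) ρ0)
    (hK : ∀ x ∈ Metric.closedBall x₀ r, ∀ x' ∈ Metric.closedBall x₀ r, ‖w x - w x'‖ ≤ K * ‖x - x'‖)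
    (hKv : ∀ x ∈ Metric.closedBall x₀ r, ∀ x' ∈ Metric.closedBall x₀ r,
      ‖v x - v x'‖ ≤ Kv * ‖x - x'‖)
    (hwv : ∀ z, ‖z - x₀‖ = r → w z = v z) :
    IntegrableOn (dens ε a μ f w) (Metric.ball x₀ r) ∧
    ∫ x in Metric.ball x₀ r, dens ε a μ f v x ≤ ∫ x in Metric.ball x₀ r, dens ε a μ f w x := by
  classical
  have hlip := glue_lip hr hK0 hKv0 hK hKv hwv
  have hcmp := compare_lip hε hμ hf hm hi hlip (R := ρ0) (fun x hx => by
    refine indicator_of_notMem (fun h => ?_) _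
    have := hsub h
    rw [mem_ball_zero_iff] at this
    linarith)
  set ψ := (Metric.closedBall x₀ r).indicator (fun x => w x - v x) with hψ
  have hmb : MeasurableSet (Metric.ball x₀ r) := Metric.isOpen_ball.measurableSet
  have hu : Continuous fun x => v x + ψ x := hm.1.1.continuous.add hlip.continuous
  have huw : ∀ x ∈ Metric.ball x₀ r, v x + ψ x = w x := fun x hx => by
    rw [hψ, indicator_of_mem (Metric.ball_subset_closedBall hx)]; abel
  have hwi : IntegrableOn (dens ε a μ f w) (Metric.ball x₀ r) :=
    dens_intOn hε hμ hf hu hK0 hK huw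
  refine ⟨hwi, ?_⟩
  have e : (fun x => dens ε a μ f (fun x => v x + ψ x) x - dens ε a μ f v x) =ᵐ[volume]
      (Metric.ball x₀ r).indicator (fun x => dens ε a μ f w x - dens ε a μ f v x) := by
    have hs : ∀ᵐ x ∂(volume : Measure E2), x ∉ Metric.sphere x₀ r :=
      measure_eq_zero_iff_ae_notMem.1 (Measure.addHaar_sphere _ x₀ r)
    filter_upwards [hs] with x hx
    by_cases hb : x ∈ Metric.ball x₀ r
    · rw [indicator_of_mem hb, dens_congr (w := w)]
      filter_upwards [Metric.isOpen_ball.mem_nhds hb] with y hy using huw y hy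
    · have hc : x ∉ Metric.closedBall x₀ r := fun hc => by
        rw [← Metric.ball_union_sphere] at hc
        exact hc.elim hb hx
      rw [indicator_of_notMem hb, dens_congr (w := v), sub_self]
      filter_upwards [Metric.isClosed_closedBall.isOpen_compl.mem_nhds hc] with y hy
      rw [hψ, indicator_of_notMem hy, add_zero]
  rw [integral_congr_ae e, integral_indicator hmb, integral_sub hwi hi.integrableOn] at hcmp
  linarith

lemma renorm_eq {ε a : ℝ} {μ : E2 → ℝ} {f v : E2 → E2} {x₀ : E2} {r Kv ρ0 ρ : ℝ} (hε : 0 < ε)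
    (hμ : Continuous μ) (hf : Continuous f) (hv : Continuous v) (hKv0 : 0 ≤ Kv) (hρ : ρ0 < ρ)
    (hsub : Metric.closedBall x₀ r ⊆ Metric.ball (0:E2) ρ0)
    (hKv : ∀ x ∈ Metric.closedBall x₀ r, ∀ x' ∈ Metric.closedBall x₀ r,
      ‖v x - v x'‖ ≤ Kv * ‖x - x'‖) :
    renormOn ε a μ f ρ v (Metric.ball x₀ r) =
      (∫ x in Metric.ball x₀ r, dens ε a μ f v x) + ∫ x in Metric.ball x₀ r, μ x^2/(4*ε^2) := by
  have hmb : MeasurableSet (Metric.ball x₀ r) := Metric.isOpen_ball.measurableSet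
  have hci : ∀ g : E2 → ℝ, Continuous g → IntegrableOn g (Metric.ball x₀ r) := fun g hg =>
    (hg.continuousOn.integrableOn_compact (isCompact_closedBall x₀ r)).mono_set
      Metric.ball_subset_closedBall
  have hs1 : Metric.ball x₀ r ⊆ Metric.ball (0:E2) ρ :=
    (Metric.ball_subset_closedBall.trans hsub).trans (Metric.ball_subset_ball hρ.le)
  have hs2 : Metric.ball x₀ r \ Metric.closedBall (0:E2) ρ = ∅ :=
    sdiff_eq_empty.2 (hs1.trans Metric.ball_subset_closedBall)
  unfold renormOn
  rw [inter_eq_left.2 hs1, hs2, setIntegral_empty, add_zero, ← integral_const_mul]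
  have hd := dens_intOn (a := a) hε hμ hf hv hKv0 hKv (fun x _ => rfl)
  have hm2 := hci (fun x => μ x^2/(4*ε^2)) (by fun_prop)
  have hH := hci (fun x => (‖v x‖^2 - μ x)^2 / (4*ε^2)) (by fun_prop)
  have hI := hci (fun x => a/ε * (inner ℝ (f x) (v x) : ℝ)) (by fun_prop)
  have hG : IntegrableOn (fun x => (1/2) * gradSq v x) (Metric.ball x₀ r) := by
    refine Measure.integrableOn_of_bounded (M := Kv^2) measure_ball_lt_top.ne
      ((gradSq_meas v).const_mul _).aestronglyMeasurable ?_
    refine (ae_restrict_iff' hmb).2 (Eventually.of_forall fun x hx => ?_)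
    have h1 := gradSq_le v x (fderiv_le_of_lipOn hKv0 hKv hx)
    have h0 := gradSq_nonneg v x
    rw [Real.norm_of_nonneg (by positivity)]; linarith
  rw [← integral_add hG hH, ← integral_sub (hG.fun_add hH) hI, ← integral_add hd hm2]
  refine setIntegral_congr_fun hmb fun x _ => ?_
  simp only [dens, Pi.add_apply]
  field_simp
  ring

lemma zp_meas (x₀ : E2) (r : ℝ) : Measurable (zp x₀ r) := by
  unfold zp
  have : Measurable fun x : E2 => r / ‖x - x₀‖ :=
    measurable_const.div (by fun_prop : Measurable fun x : E2 => ‖x - x₀‖)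
  exact measurable_const.add (this.smul (by fun_prop : Measurable fun x : E2 => x - x₀))

/-- integrability on the disc of a function composed with the radial projection -/
lemma zp_intOn {x₀ : E2} {r B : ℝ} (hr : 0 < r) {Φ : E2 → ℝ} (hΦ : Measurable Φ)
    (hB : ∀ z, ‖z - x₀‖ = r → |Φ z| ≤ B) :
    IntegrableOn (fun x => Φ (zp x₀ r x)) (Metric.ball x₀ r) := by
  refine Measure.integrableOn_of_bounded (M := B) measure_ball_lt_top.ne
    (hΦ.comp (zp_meas x₀ r)).aestronglyMeasurable ?_
  have : ∀ᵐ x ∂(volume.restrict (Metric.ball x₀ r)), x ≠ x₀ :=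
    ae_restrict_of_ae (Measure.ae_ne volume x₀)
  filter_upwards [this] with x hx
  exact hB _ (zp_norm hr hx)

lemma ball_const (x₀ : E2) {r : ℝ} (hr : 0 < r) (c : ℝ) :
    ∫ _ in Metric.ball x₀ r, c = π * r^2 * c := by
  have := polar_disc x₀ hr (fun _ => c)
  rw [this, intervalIntegral.integral_const, smul_eq_mul]; ring

/-- bound of the integral of the majorant -/
lemma major_bound {x₀ : E2} {r ε σ A1 A2 A3 B B' : ℝ} {G H : E2 → ℝ} (hr : 0 < r) (hε : 0 < ε)
    (hA1 : 0 ≤ A1) (hA2 : 0 ≤ A2)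
    (hG : Measurable G) (hH : Measurable H) (hGB : ∀ z, ‖z - x₀‖ = r → |G z| ≤ B)
    (hHB : ∀ z, ‖z - x₀‖ = r → |H z| ≤ B')
    (h1 : (∫ θ in (0:ℝ)..(2*π), G (x₀ + r • uvec θ)) ≤ 2 * σ^2 / r^2)
    (h2 : (∫ θ in (0:ℝ)..(2*π), H (x₀ + r • uvec θ)) ≤ 4 * ε^2 * σ^2 / r^2) :
    IntegrableOn (fun x => A1 * G (zp x₀ r x) + A2 / ε^2 * H (zp x₀ r x) +
      (A1 * (1 + 1/r^2) + A3)) (Metric.ball x₀ r) ∧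
    ∫ x in Metric.ball x₀ r, (A1 * G (zp x₀ r x) + A2 / ε^2 * H (zp x₀ r x) +
      (A1 * (1 + 1/r^2) + A3)) ≤
      A1 * σ^2 + A2 * (2 * σ^2) + (π * r^2 * A1 + π * A1 + π * (r^2 * A3)) := by
  have i1 := (zp_intOn hr hG hGB).const_mul A1
  have i2 := (zp_intOn hr hH hHB).const_mul (A2/ε^2)
  have i3 : IntegrableOn (fun _ => (A1 * (1 + 1/r^2) + A3)) (Metric.ball x₀ r) :=
    integrableOn_const measure_ball_lt_top.ne
  refine ⟨(i1.add i2).add i3, ?_⟩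
  rw [integral_add (i1.fun_add i2) i3, integral_add i1 i2, integral_const_mul, integral_const_mul,
    ball_const x₀ hr]
  have e1 : ∫ x in Metric.ball x₀ r, G (zp x₀ r x) = r^2/2 * _ := polar_disc x₀ hr G
  have e2 : ∫ x in Metric.ball x₀ r, H (zp x₀ r x) = r^2/2 * _ := polar_disc x₀ hr H
  rw [e1, e2]
  have b1 : r^2/2 * (∫ θ in (0:ℝ)..(2*π), G (x₀ + r • uvec θ)) ≤ σ^2 := by
    calc _ ≤ r^2/2 * (2 * σ^2 / r^2) := by gcongr
      _ = σ^2 := by field_simp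
  have b2 : r^2/2 * (∫ θ in (0:ℝ)..(2*π), H (x₀ + r • uvec θ)) ≤ 2 * ε^2 * σ^2 := by
    calc _ ≤ r^2/2 * (4 * ε^2 * σ^2 / r^2) := by gcongr
      _ = 2 * ε^2 * σ^2 := by field_simp; ring
  have c1 := mul_le_mul_of_nonneg_left b1 hA1
  have c2 := mul_le_mul_of_nonneg_left b2 (by positivity : 0 ≤ A2/ε^2)
  have c3 : A2/ε^2 * (2 * ε^2 * σ^2) = A2 * (2*σ^2) := by field_simp
  have c4 : π * r^2 * (A1 * (1 + 1/r^2) + A3) = π * r^2 * A1 + π * A1 + π * (r^2 * A3) := by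
    field_simp
  linarith


lemma cs_three (q s : ℝ) : (1 + q + s)^2 ≤ 3 * (1 + q^2 + s^2) := by
  nlinarith [sq_nonneg (1-q), sq_nonneg (1-s), sq_nonneg (q-s)]

lemma grad_young {v w : E2 → E2} {x z : E2} {A r : ℝ}
    (s0 : ‖fderiv ℝ w x (e2basis 0)‖ ≤ A * (1 + 1/r + √(gradSq v z)))
    (s1 : ‖fderiv ℝ w x (e2basis 1)‖ ≤ A * (1 + 1/r + √(gradSq v z))) :
    (1/2) * gradSq w x ≤ 3*A^2 * gradSq v z + 3*A^2*(1 + 1/r^2) := by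
  have hs : √(gradSq v z)^2 = gradSq v z := Real.sq_sqrt (gradSq_nonneg v z)
  have hq2 : 1/r^2 = (1/r)^2 := by ring
  have t0 := pow_le_pow_left₀ (norm_nonneg _) s0 2
  have t1 := pow_le_pow_left₀ (norm_nonneg _) s1 2
  have := mul_le_mul_of_nonneg_left (cs_three (1/r) (√(gradSq v z))) (sq_nonneg A)
  have e : gradSq w x = ‖fderiv ℝ w x (e2basis 0)‖^2 + ‖fderiv ℝ w x (e2basis 1)‖^2 := by
    unfold gradSq
    rw [Fin.sum_univ_two]
  rw [mul_pow] at t0 t1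
  rw [hs] at this
  rw [e, hq2]
  linarith

set_option maxHeartbeats 1000000 in
lemma disc_bound {ε a : ℝ} {μ : E2 → ℝ} {f v : E2 → E2} {x₀ : E2} {r σ κ M Lμ m0 Mμ Cf ρ0 ρ A T : ℝ}
    (hε : 0 < ε) (hεr : ε ≤ r) (hσ : 0 < σ) (hκ : 0 < κ) (hm0 : 0 < m0) (hκm : 8 * κ^2 ≤ m0)
    (hσm : σ ≤ m0/2) (hσκ : 5 * σ ≤ κ) (hκM : κ ≤ M) (hMM : Mμ ≤ M^2) (hMM2 : Mμ + σ ≤ (M - κ)^2)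
    (hμ : Differentiable ℝ μ) (hf : Continuous f) (hm : IsMinimizer ε a μ f v)
    (hi : Integrable (dens ε a μ f v)) (hρ : ρ0 < ρ)
    (hsub : Metric.closedBall x₀ r ⊆ Metric.ball (0:E2) ρ0)
    (hμm : ∀ x ∈ Metric.closedBall x₀ r, m0 ≤ μ x) (hμM : ∀ x, μ x ≤ Mμ)
    (hμL : ∀ x ∈ Metric.closedBall x₀ r, ‖fderiv ℝ μ x‖ ≤ Lμ)
    (hCf : ∀ x, ‖f x‖ ≤ Cf) (ha : 0 ≤ a) (hT : a/ε ≤ T)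
    (hA : A = 2 * (1/(2*√m0) * Lμ) + 1 + M + 4 * M / κ * (1 + M))
    (hb : (∫ θ in (0:ℝ)..(2*π), r * ((1/2) * gradSq v (x₀ + r • uvec θ) +
            (‖v (x₀ + r • uvec θ)‖^2 - μ (x₀ + r • uvec θ))^2 / (4*ε^2))) ≤ σ^2 / r) :
    renormOn ε a μ f ρ v (Metric.ball x₀ r) ≤
      (3*A^2) * σ^2 + (9*M^2/(4*m0)) * (2 * σ^2) + (π * r^2 * (3*A^2) + π * (3*A^2) +
        π * (r^2 * (T * (Cf * (2*M))))) := by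
  have hr : 0 < r := hε.trans_le hεr
  have hM : 0 < M := hκ.trans_le hκM
  have hμc := hμ.continuous
  have hvd := hm.1.1
  have hvc := hvd.continuous
  have hx₀ : x₀ ∈ Metric.closedBall x₀ r := Metric.mem_closedBall_self hr.le
  have hLμ : 0 ≤ Lμ := (norm_nonneg _).trans (hμL x₀ hx₀)
  have hCf0 : 0 ≤ Cf := (norm_nonneg _).trans (hCf x₀)
  have hcb : ∀ z, ‖z - x₀‖ = r → z ∈ Metric.closedBall x₀ r := fun z hz => by
    rw [mem_closedBall_iff_norm, hz]
  have hsm : 0 < √m0 := Real.sqrt_pos.2 hm0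
  obtain ⟨L, hL⟩ := grad_bdd hε hμc hf hm hi ρ0
  have hL' : ∀ x ∈ Metric.closedBall x₀ r, ‖fderiv ℝ v x‖ ≤ L := fun x hx =>
    hL x (mem_ball_zero_iff.1 (hsub hx)).le
  have hL0 : 0 ≤ L := (norm_nonneg _).trans (hL' x₀ hx₀)
  have hKv : ∀ x ∈ Metric.closedBall x₀ r, ∀ x' ∈ Metric.closedBall x₀ r,
      ‖v x - v x'‖ ≤ L * ‖x - x'‖ := fun x hx x' hx' =>
    (convex_closedBall x₀ r).norm_image_sub_le_of_norm_fderiv_le (fun y _ => hvd y) hL' hx' hx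
  obtain ⟨hG, hH, c, ⟨z0, hz0, hz0c, hz0σ⟩, hcc⟩ :=
    circle_est hvd hμc hε hεr hσ (fun x hx => hL' x (hcb x hx)) hb
  have hc2 : 2 * κ ≤ ‖c‖ := by
    have h1 := hμm z0 (hcb z0 hz0)
    have h2 := (abs_le.1 hz0σ).1
    rw [hz0c] at h2
    refine (sq_le_sq₀ (by linarith) (norm_nonneg c)).1 ?_
    nlinarith
  have hcM : ‖c‖ ≤ M - κ := by
    have h1 := hμM z0
    have h2 := (abs_le.1 hz0σ).2
    rw [hz0c] at h2
    refine (sq_le_sq₀ (norm_nonneg c) (by linarith)).1 ?_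
    nlinarith
  have hvc' : ∀ z, ‖z - x₀‖ = r → ‖v z - c‖ ≤ κ := fun z hz => (hcc z hz).trans hσκ
  have hκv : ∀ z, ‖z - x₀‖ = r → κ ≤ ‖v z‖ := fun z hz => by
    have h1 := norm_sub_norm_le c (v z)
    rw [norm_sub_rev] at h1
    have := hvc' z hz
    linarith
  have hMv : ∀ z, ‖z - x₀‖ = r → ‖v z‖ ≤ M := fun z hz => by
    have h1 := norm_sub_norm_le (v z) c
    have := hvc' z hz
    linarith
  set β : E2 → ℝ := fun x => √(μ x) with hβ
  have hβ2 : ∀ x ∈ Metric.closedBall x₀ r, β x^2 = μ x := fun x hx =>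
    Real.sq_sqrt (hm0.le.trans (hμm x hx))
  have hβder : ∀ x ∈ Metric.closedBall x₀ r,
      HasFDerivAt β ((1/(2*√(μ x))) • fderiv ℝ μ x) x := fun x hx =>
    (hμ x).hasFDerivAt.sqrt (hm0.trans_le (hμm x hx)).ne'
  have hβm : ∀ x ∈ Metric.closedBall x₀ r, √m0 ≤ β x := fun x hx => Real.sqrt_le_sqrt (hμm x hx)
  obtain ⟨w, ⟨K, hK0, hK⟩, hwv, hw⟩ := competitor (Lb := 1/(2*√m0) * Lμ) (β := β) hr hκ hκM
    (by positivity) hL0 hvd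
    (fun z z' hz hz' => hKv z (hcb z hz) z' (hcb z' hz')) hκv hMv hc2 hvc'
    (fun x hx => (hβder x hx).differentiableAt)
    (fun x hx => by
      rw [(hβder x hx).fderiv, norm_smul, Real.norm_of_nonneg (by positivity)]
      have h1 := hβm x hx
      have h2 := hμL x hx
      have h3 : 1/(2*√(μ x)) ≤ 1/(2*√m0) := by
        apply one_div_le_one_div_of_le (by positivity)
        linarith
      exact mul_le_mul h3 h2 (norm_nonneg _) (by positivity))
    (fun x _ => Real.sqrt_nonneg _)
    (fun x _ => by
      rw [hβ]
      exact (Real.sqrt_le_sqrt ((hμM x).trans hMM)).trans_eq (Real.sqrt_sq hM.le))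
  rw [← hA] at hw
  obtain ⟨hwi, hcmp⟩ := ball_compare hε hμc hf hm hi hr hK0 hL0 hsub hK hKv hwv
  rw [renorm_eq hε hμc hf hvc hL0 hρ hsub hKv]
  have hm2 : IntegrableOn (fun x => μ x^2/(4*ε^2)) (Metric.ball x₀ r) :=
    ((by fun_prop : Continuous fun x => μ x^2/(4*ε^2)).continuousOn.integrableOn_compact
      (isCompact_closedBall x₀ r)).mono_set Metric.ball_subset_closedBall
  have hHc : Continuous fun z => (‖v z‖^2 - μ z)^2 := by fun_prop
  obtain ⟨BH, hBH⟩ := (isCompact_closedBall x₀ r).exists_bound_of_continuousOn hHc.continuousOn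
  obtain ⟨hmi, hmb⟩ := major_bound (A1 := 3*A^2) (A2 := 9*M^2/(4*m0)) (A3 := T * (Cf * (2*M)))
    (B := 2 * L^2) (B' := BH) hr hε (by positivity) (by positivity) (gradSq_meas v) hHc.measurable
    (fun z hz => by
      rw [abs_of_nonneg (gradSq_nonneg v z)]
      exact gradSq_le v z (hL' z (hcb z hz)))
    (fun z hz => hBH z (hcb z hz)) hG hH
  refine le_trans (add_le_add_left hcmp _) (le_trans ?_ hmb)
  rw [← integral_add hwi hm2]
  have hne : ∀ᵐ x ∂(volume.restrict (Metric.ball x₀ r)), x ≠ x₀ :=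
    ae_restrict_of_ae (Measure.ae_ne volume x₀)
  refine integral_mono_ae (hwi.fun_add hm2) hmi ?_
  filter_upwards [hne, ae_restrict_mem Metric.isOpen_ball.measurableSet] with x hx hxb
  obtain ⟨-, hw1, hw2, hw3⟩ := hw x hxb hx
  have hxc := Metric.ball_subset_closedBall hxb
  have hz := zp_norm hr hx
  set z := zp x₀ r x with hzdef
  have hzc := hcb z hz
  have hg0 := gradSq_nonneg v z
  have b1 : (1/2) * gradSq w x ≤ 3*A^2 * gradSq v z + 3*A^2*(1 + 1/r^2) := by
    exact grad_young (hw3 (e2basis 0) (e2basis_norm 0)) (hw3 (e2basis 1) (e2basis_norm 1))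
  have b2 : (‖w x‖^2 - μ x)^2 / (4*ε^2) ≤ 9*M^2/(4*m0)/ε^2 * (‖v z‖^2 - μ z)^2 := by
    rw [hβ2 x hxc] at hw2
    have h1 : (‖v z‖ - β z)^2 ≤ (‖v z‖^2 - μ z)^2 / m0 := by
      rw [le_div_iff₀ hm0, ← hβ2 z hzc]
      have h2 : m0 ≤ (‖v z‖ + β z)^2 := by
        have := hβm z hzc
        have h3 := norm_nonneg (v z)
        calc m0 = √m0^2 := (Real.sq_sqrt hm0.le).symm
          _ ≤ _ := pow_le_pow_left₀ hsm.le (by linarith) 2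
      calc _ ≤ (‖v z‖ - β z)^2 * (‖v z‖ + β z)^2 := by gcongr
        _ = _ := by ring
    calc _ ≤ (9 * M^2 * ((‖v z‖^2 - μ z)^2 / m0)) / (4*ε^2) := by
          gcongr
          exact hw2.trans (by gcongr)
      _ = _ := by field_simp
  have b3 : -((a/ε) * (inner ℝ (f x) (w x) : ℝ)) ≤ T * (Cf * (2*M)) := by
    have hae : 0 ≤ a/ε := by positivity
    have h1 : |(inner ℝ (f x) (w x) : ℝ)| ≤ Cf * (2*M) :=
      (abs_real_inner_le_norm _ _).trans (mul_le_mul (hCf x) hw1 (norm_nonneg _) hCf0)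
    calc _ = (a/ε) * (-(inner ℝ (f x) (w x) : ℝ)) := by ring
      _ ≤ (a/ε) * (Cf * (2*M)) := by
        gcongr
        exact (neg_le_abs _).trans h1
      _ ≤ _ := by gcongr
  have e : dens ε a μ f w x + μ x^2/(4*ε^2) = (1/2) * gradSq w x + (‖w x‖^2 - μ x)^2 / (4*ε^2)
      + -((a/ε) * (inner ℝ (f x) (w x) : ℝ)) := by
    unfold dens
    field_simp
    ring
  simp only [e]
  linarith


/-- if `a(ε) ≤ b₀ε|ln ε|`, there are `λ > 0` and `C > 0` such that
for every disc `D(x₀;r₀) ⊆ D(0;ρ₀)` with `r₀ ∈ [ε, |ln ε|^{-1/2}]`, the boundary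
estimate `∫_{∂D(x₀;r₀)} (1/2)|∇v_ε|² + (|v_ε|²−μ)²/(4ε²) ≤ λ/r₀` implies
`𝓔(v_ε, D(x₀;r₀)) ≤ C`. -/
theorem statement16
    (μ : E2 → ℝ) (μrad : ℝ → ℝ) (ρ : ℝ) (f : E2 → E2) (frad : ℝ → ℝ)
    (hμ : MuHyp μ μrad ρ) (hf : FHyp f frad)
    (ρ0 : ℝ) (hρ0 : 0 < ρ0) (hρ0ρ : ρ0 < ρ)
    (b0 : ℝ) (hb0 : 0 < b0)
    (a : ℝ → ℝ) (ha0 : ∀ ε : ℝ, 0 < ε → 0 ≤ a ε)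
    (haB : ∀ ε : ℝ, 0 < ε → ε < 1 → a ε ≤ b0 * ε * |Real.log ε|)
    (v : ℝ → E2 → E2) (hv : ∀ ε : ℝ, 0 < ε → IsMinimizer ε (a ε) μ f (v ε)) :
    ∃ lam C : ℝ, 0 < lam ∧ 0 < C ∧ ∃ ε₀ : ℝ, 0 < ε₀ ∧
      ∀ ε : ℝ, 0 < ε → ε < ε₀ → ∀ (x₀ : E2) (r₀ : ℝ),
        Metric.closedBall x₀ r₀ ⊆ Metric.ball (0:E2) ρ0 →
        ε ≤ r₀ → r₀ ≤ |Real.log ε|^(-(1/2:ℝ)) →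
        (∫ θ in (0:ℝ)..(2*π), r₀ * ((1/2) * gradSq (v ε) (x₀ + r₀ • uvec θ) +
            (‖v ε (x₀ + r₀ • uvec θ)‖^2 - μ (x₀ + r₀ • uvec θ))^2 / (4*ε^2))) ≤ lam / r₀ →
        renormOn ε (a ε) μ f ρ (v ε) (Metric.ball x₀ r₀) ≤ C := by
  obtain ⟨hm0, hmge⟩ := mu_pos hμ hρ0 hρ0ρ
  set m0 := μrad ρ0 with hm0def
  obtain ⟨Mμ, hMμ⟩ := hμ.bdd
  obtain ⟨Cf, hCf⟩ := hf.bdd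
  have hμd : Differentiable ℝ μ := hμ.smooth.differentiable (by simp)
  have hMμ0 : 0 ≤ Mμ := (abs_nonneg _).trans (hMμ 0)
  have hCf0 : 0 ≤ Cf := (norm_nonneg _).trans (hCf 0)
  obtain ⟨Lμ, hLμ⟩ := (isCompact_closedBall (0:E2) ρ0).exists_bound_of_continuousOn
    (hμ.smooth.continuous_fderiv (by simp)).continuousOn
  obtain ⟨ε₁, hε₁, hdint⟩ := dens_integrable hμ hf.smooth.continuous hρ0 hρ0ρ
  set κ : ℝ := √(m0/8) with hκdef
  have hκ : 0 < κ := Real.sqrt_pos.2 (by positivity)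
  have hκ2 : κ^2 = m0/8 := Real.sq_sqrt (by positivity)
  set σ : ℝ := min (m0/2) (κ/5) with hσdef
  have hσ : 0 < σ := lt_min (by positivity) (by positivity)
  set M : ℝ := √(Mμ + σ) + κ with hMdef
  have hMs : √(Mμ + σ)^2 = Mμ + σ := Real.sq_sqrt (by positivity)
  have hs0 := Real.sqrt_nonneg (Mμ + σ)
  set A : ℝ := 2 * (1/(2*√m0) * Lμ) + 1 + M + 4 * M / κ * (1 + M) with hA
  have hM0 : 0 < M := by positivity
  refine ⟨σ^2, (3*A^2) * σ^2 + (9*M^2/(4*m0)) * (2 * σ^2) + (π * ρ0^2 * (3*A^2) + π * (3*A^2) +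
        π * (b0 * (Cf * (2*M)))) + 1, by positivity, by positivity, min (1/2) ε₁,
        lt_min (by norm_num) hε₁, ?_⟩
  intro ε hε hε0 x₀ r hsub hεr hrl hb
  have hε1 : ε < 1 := (hε0.trans_le (min_le_left _ _)).trans (by norm_num)
  have hr : 0 < r := hε.trans_le hεr
  have hlog : 0 < |Real.log ε| := abs_pos.2 (Real.log_neg hε hε1).ne
  have hr2 : r^2 * |Real.log ε| ≤ 1 := by
    have h1 : r^2 ≤ (|Real.log ε|^(-(1/2:ℝ)))^2 := pow_le_pow_left₀ hr.le hrl 2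
    have h2 : (|Real.log ε|^(-(1/2:ℝ)))^2 = |Real.log ε|⁻¹ := by
      rw [← Real.rpow_natCast, ← Real.rpow_mul hlog.le, ← Real.rpow_neg_one]
      norm_num
    rw [h2] at h1
    calc _ ≤ |Real.log ε|⁻¹ * |Real.log ε| := by gcongr
      _ = 1 := inv_mul_cancel₀ hlog.ne'
  have hrρ : r ≤ ρ0 := by
    have h1 : x₀ + r • e2basis 0 ∈ Metric.ball (0:E2) ρ0 := hsub (by
      rw [mem_closedBall_iff_norm, add_sub_cancel_left, norm_smul, e2basis_norm, mul_one,
        Real.norm_of_nonneg hr.le])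
    have h2 : x₀ - r • e2basis 0 ∈ Metric.ball (0:E2) ρ0 := hsub (by
      rw [mem_closedBall_iff_norm, sub_sub_cancel_left, norm_neg, norm_smul, e2basis_norm, mul_one,
        Real.norm_of_nonneg hr.le])
    rw [mem_ball_zero_iff] at h1 h2
    have h3 := norm_sub_le (x₀ + r • e2basis 0) (x₀ - r • e2basis 0)
    have h4 : (x₀ + r • e2basis 0) - (x₀ - r • e2basis 0) = (2*r) • e2basis 0 := by module
    rw [h4, norm_smul, e2basis_norm, mul_one, Real.norm_of_nonneg (by positivity)] at h3
    linarith
  have hsub' : Metric.closedBall x₀ r ⊆ Metric.closedBall (0:E2) ρ0 :=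
    hsub.trans Metric.ball_subset_closedBall
  have hT : a ε / ε ≤ b0 * |Real.log ε| := by
    rw [div_le_iff₀ hε]
    have := haB ε hε hε1
    linarith
  have key := disc_bound (A := A) (T := b0 * |Real.log ε|) (σ := σ) (κ := κ) (M := M) (m0 := m0)
    (Mμ := Mμ) (Lμ := Lμ) (Cf := Cf) (ρ := ρ) hε hεr hσ hκ hm0 (by rw [hκ2]; linarith)
    (min_le_left _ _) (by have := min_le_right (m0/2) (κ/5); linarith) (by linarith)
    (by rw [hMdef]; nlinarith) (by rw [hMdef, add_sub_cancel_right, hMs]) hμd hf.smooth.continuous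
    (hv ε hε) (hdint ε (a ε) (v ε) hε (hε0.trans_le (min_le_right _ _)) (hv ε hε)) hρ0ρ hsub
    (fun x hx => hmge x (hsub' hx)) (fun x => (le_abs_self _).trans (hMμ x))
    (fun x hx => hLμ x (hsub' hx)) hCf (ha0 ε hε) hT hA hb
  refine key.trans ?_
  have k1 : π * r^2 * (3*A^2) ≤ π * ρ0^2 * (3*A^2) := by gcongr
  have k2 : π * (r^2 * (b0 * |Real.log ε| * (Cf * (2*M)))) ≤ π * (b0 * (Cf * (2*M))) := by
    have : r^2 * (b0 * |Real.log ε| * (Cf * (2*M))) = (r^2 * |Real.log ε|) * (b0 * (Cf * (2*M))) := by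
      ring
    rw [this]
    have h0 : 0 ≤ b0 * (Cf * (2*M)) := by positivity
    exact mul_le_mul_of_nonneg_left (mul_le_of_le_one_left h0 hr2) Real.pi_pos.le
  linarith
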